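/- Let p: B → G be a Fell bundle over a locally compact Hausdorff groupoid G, A := Γ₀(G⁰; B), and I an ideal of A. Let B_I := {b ∈ B : b*b ∈ I(s(b))} and p_I := p restricted to B_I. Then p_I : B_I → G is an upper semicontinuous Banach bundle (with the subspace topology) whose fibres are B_I(x) = B(x)·I(s(x)). If moreover I is G-invariant, then B_I with the operations inherited from B is a Fell bundle over G, with B_I(u) = I(u) for units u and each B_I(x) an I(r(x))–I(s(x))-imprimitivity bimodule. -/

import Mathlib

noncomputable section

open Filter
open scoped Topology

/-- A locally compact Hausdorff groupoid, encoded "flatly": the partially defined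
multiplication `gmul` is a total function whose value is only meaningful (and only
constrained by the axioms) on composable pairs, i.e. pairs `(x, y)` with
`src x = rng y`. -/
structure LCGroupoid where
  /-- the underlying space of the groupoid -/
  G : Type
  [topG : TopologicalSpace G]
  t2G : T2Space G
  lcG : LocallyCompactSpace G
  /-- the source map (with values in the unit space) -/
  src : G → G
  /-- the range map (with values in the unit space) -/
  rng : G → G
  /-- the partial multiplication (junk value unless `src x = rng y`) -/
  gmul : G → G → G
  /-- inversion -/
  ginv : G → G
  src_rng : ∀ x, src (rng x) = rng x
  rng_rng : ∀ x, rng (rng x) = rng x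
  src_src : ∀ x, src (src x) = src x
  rng_src : ∀ x, rng (src x) = src x
  rng_gmul : ∀ x y, src x = rng y → rng (gmul x y) = rng x
  src_gmul : ∀ x y, src x = rng y → src (gmul x y) = src y
  gmul_assoc : ∀ x y z, src x = rng y → src y = rng z →
    gmul (gmul x y) z = gmul x (gmul y z)
  gmul_rng : ∀ x, gmul (rng x) x = x
  gmul_src : ∀ x, gmul x (src x) = x
  src_ginv : ∀ x, src (ginv x) = rng x
  rng_ginv : ∀ x, rng (ginv x) = src x
  ginv_ginv : ∀ x, ginv (ginv x) = x
  gmul_ginv : ∀ x, gmul x (ginv x) = rng x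
  ginv_gmul : ∀ x, gmul (ginv x) x = src x
  ginv_gmul_eq : ∀ x y, src x = rng y → ginv (gmul x y) = gmul (ginv y) (ginv x)
  ginv_unit : ∀ u, rng u = u → ginv u = u
  cont_ginv : Continuous ginv
  cont_gmul : Continuous (fun q : {q : G × G // src q.1 = rng q.2} => gmul q.1.1 q.1.2)

attribute [instance] LCGroupoid.topG

/-- The unit space `G⁰` of the groupoid, i.e. the set of units, with its subspace
topology. -/
def LCGroupoid.UnitSpace (Γ : LCGroupoid) : Type := {u : Γ.G // Γ.rng u = u}

instance (Γ : LCGroupoid) : TopologicalSpace Γ.UnitSpace :=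
  instTopologicalSpaceSubtype

/-- The data and most axioms of a Fell bundle `p : B → G` over a locally compact
Hausdorff groupoid, again encoded "flatly": the total space is `T`, the fibre
`B(x)` is `{b : T | p b = x}`, the fibrewise algebraic operations are total
functions which are constrained by the axioms only on the appropriate domains
(e.g. `badd` on pairs in a common fibre, `bmul` on pairs whose base points are
composable).  The axioms say: each fibre is a complex Banach space (whose
topology is the subspace topology); the norm is upper semicontinuous and the
bundle operations are continuous; `bmul`/`bstar` are a continuous bilinear
associative multiplication and involution covering the groupoid operations;
each unit fibre `B(u)` is a C*-algebra (C*-identity, submultiplicativity,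
positivity of `b* b`). Saturation is added in `FellBundle` below. -/
structure FellBundleData extends LCGroupoid where
  /-- the total space of the bundle -/
  T : Type
  [topT : TopologicalSpace T]
  /-- the bundle projection -/
  p : T → G
  /-- the fibrewise norm -/
  bnorm : T → ℝ
  /-- fibrewise addition (junk unless both arguments lie in a common fibre) -/
  badd : T → T → T
  /-- fibrewise scalar multiplication -/
  bsmul : ℂ → T → T
  /-- the zero section -/
  bzero : G → T
  /-- the Fell bundle multiplication (junk unless `src (p a) = rng (p b)`) -/
  bmul : T → T → T
  /-- the Fell bundle involution -/
  bstar : T → T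
  p_cont : Continuous p
  p_open : IsOpenMap p
  p_badd : ∀ a b, p a = p b → p (badd a b) = p a
  p_bsmul : ∀ c a, p (bsmul c a) = p a
  p_bzero : ∀ x, p (bzero x) = x
  p_bmul : ∀ a b, src (p a) = rng (p b) → p (bmul a b) = gmul (p a) (p b)
  p_bstar : ∀ a, p (bstar a) = ginv (p a)
  badd_comm : ∀ a b, p a = p b → badd a b = badd b a
  badd_assoc : ∀ a b c, p a = p b → p b = p c → badd (badd a b) c = badd a (badd b c)
  bzero_badd : ∀ a, badd (bzero (p a)) a = a
  badd_neg : ∀ a, badd a (bsmul (-1) a) = bzero (p a)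
  one_bsmul : ∀ a, bsmul 1 a = a
  mul_bsmul : ∀ c d a, bsmul (c * d) a = bsmul c (bsmul d a)
  add_bsmul : ∀ c d a, bsmul (c + d) a = badd (bsmul c a) (bsmul d a)
  bsmul_badd : ∀ c a b, p a = p b → bsmul c (badd a b) = badd (bsmul c a) (bsmul c b)
  zero_bsmul : ∀ a, bsmul 0 a = bzero (p a)
  bsmul_bzero : ∀ c x, bsmul c (bzero x) = bzero x
  bnorm_nonneg : ∀ a, 0 ≤ bnorm a
  bnorm_badd_le : ∀ a b, p a = p b → bnorm (badd a b) ≤ bnorm a + bnorm b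
  bnorm_bsmul : ∀ c a, bnorm (bsmul c a) = ‖c‖ * bnorm a
  bnorm_eq_zero : ∀ a, bnorm a = 0 ↔ a = bzero (p a)
  /-- each fibre is complete -/
  fiber_complete : ∀ x (f : ℕ → T), (∀ n, p (f n) = x) →
    (∀ ε : ℝ, 0 < ε → ∃ N, ∀ m n, N ≤ m → N ≤ n →
      bnorm (badd (f m) (bsmul (-1) (f n))) < ε) →
    ∃ L, p L = x ∧
      Tendsto (fun n => bnorm (badd (f n) (bsmul (-1) L))) atTop (nhds 0)
  cont_badd : Continuous (fun q : {q : T × T // p q.1 = p q.2} => badd q.1.1 q.1.2)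
  cont_bsmul : Continuous (fun q : ℂ × T => bsmul q.1 q.2)
  cont_bzero : Continuous bzero
  usc_bnorm : UpperSemicontinuous bnorm
  /-- on each fibre, the subspace topology is finer than the norm topology -/
  fiber_nbhd_norm : ∀ b, ∀ ε : ℝ, 0 < ε →
    ∃ U ∈ nhds b, ∀ c ∈ U, p c = p b → bnorm (badd c (bsmul (-1) b)) < ε
  /-- on each fibre, the norm topology is finer than the subspace topology -/
  norm_nbhd_fiber : ∀ b, ∀ U ∈ nhds b, ∃ ε : ℝ, 0 < ε ∧
    ∀ c, p c = p b → bnorm (badd c (bsmul (-1) b)) < ε → c ∈ U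
  /-- if `‖b_i‖ → 0` and `p (b_i) → x` then `b_i → 0_x` -/
  zero_nbhd : ∀ x, ∀ U ∈ nhds (bzero x), ∃ V ∈ nhds x, ∃ ε : ℝ, 0 < ε ∧
    ∀ b, p b ∈ V → bnorm b < ε → b ∈ U
  bmul_assoc : ∀ a b c, src (p a) = rng (p b) → src (p b) = rng (p c) →
    bmul (bmul a b) c = bmul a (bmul b c)
  bmul_badd : ∀ a a' b, p a = p a' → src (p a) = rng (p b) →
    bmul (badd a a') b = badd (bmul a b) (bmul a' b)
  badd_bmul : ∀ a b b', p b = p b' → src (p a) = rng (p b) →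
    bmul a (badd b b') = badd (bmul a b) (bmul a b')
  bsmul_bmul : ∀ (c : ℂ) a b, src (p a) = rng (p b) →
    bmul (bsmul c a) b = bsmul c (bmul a b)
  bmul_bsmul : ∀ (c : ℂ) a b, src (p a) = rng (p b) →
    bmul a (bsmul c b) = bsmul c (bmul a b)
  cont_bmul :
    Continuous (fun q : {q : T × T // src (p q.1) = rng (p q.2)} => bmul q.1.1 q.1.2)
  bstar_bstar : ∀ a, bstar (bstar a) = a
  bstar_badd : ∀ a b, p a = p b → bstar (badd a b) = badd (bstar a) (bstar b)
  bstar_bsmul : ∀ c a, bstar (bsmul c a) = bsmul (starRingEnd ℂ c) (bstar a)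
  bstar_bmul : ∀ a b, src (p a) = rng (p b) →
    bstar (bmul a b) = bmul (bstar b) (bstar a)
  cont_bstar : Continuous bstar
  /-- the C*-identity `‖b* b‖ = ‖b‖ ^ 2` (this holds in every fibre since `B(x)` is
  an imprimitivity bimodule with inner products `⟨a, b⟩ = a* b` and `a b*`) -/
  cstar_identity : ∀ a, bnorm (bmul (bstar a) a) = bnorm a ^ 2
  /-- the norm on each unit fibre (a C*-algebra) is submultiplicative -/
  unit_submul : ∀ a b, p a = p b → rng (p a) = p a →
    bnorm (bmul a b) ≤ bnorm a * bnorm b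
  /-- `b* b ≥ 0` in the C*-algebra `B(s(b))`: positivity in a C*-algebra is
  encoded as being of the form `c* c` -/
  bmul_pos : ∀ a, ∃ c, p c = src (p a) ∧ bmul (bstar a) a = bmul (bstar c) c

attribute [instance] FellBundleData.topT

namespace FellBundleData

variable (Ω : FellBundleData)

/-- The fibre `B(x)` of the bundle over `x`, as a subset of the total space. -/
def fiberSet (x : Ω.G) : Set Ω.T := {b | Ω.p b = x}

/-- Finite sums of elements of `S`, computed in the fibre over `x`. -/
def finSums (x : Ω.G) (S : Set Ω.T) : Set Ω.T :=
  {t | ∃ l : List Ω.T, (∀ a ∈ l, a ∈ S) ∧ t = l.foldr Ω.badd (Ω.bzero x)}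

/-- The linear span of `S` inside the fibre over `x`. -/
def spanIn (x : Ω.G) (S : Set Ω.T) : Set Ω.T :=
  Ω.finSums x {t | ∃ c s, s ∈ S ∧ t = Ω.bsmul c s}

/-- The closed linear span of `S` inside the fibre over `x`. -/
def closedSpan (x : Ω.G) (S : Set Ω.T) : Set Ω.T := closure (Ω.spanIn x S)

end FellBundleData

/-- A (saturated) Fell bundle over a locally compact Hausdorff groupoid. -/
structure FellBundle extends FellBundleData where
  /-- saturation: `B(x) B(y)` spans a dense subspace of `B(xy)` -/
  saturated : ∀ x y, src x = rng y →
    toFellBundleData.closedSpan (gmul x y)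
        {t | ∃ a b, p a = x ∧ p b = y ∧ t = bmul a b} =
      toFellBundleData.fiberSet (gmul x y)

namespace FellBundleData

variable (Ω : FellBundleData)

/-- `Ω.IsA σ` says that `σ` is an element of the C*-algebra `A = Γ₀(G⁰; B)` of the
Fell bundle sitting over the unit space: a continuous section over `G⁰` vanishing
at infinity. -/
def IsA (σ : Ω.toLCGroupoid.UnitSpace → Ω.T) : Prop :=
  (∀ u, Ω.p (σ u) = u.1) ∧ Continuous σ ∧
    ∀ ε : ℝ, 0 < ε →
      ∃ K : Set Ω.toLCGroupoid.UnitSpace, IsCompact K ∧ ∀ u ∉ K, Ω.bnorm (σ u) < ε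

/-- `Ω.IsIdealA J` says that `J` is a (closed, two-sided) ideal in the C*-algebra
`A = Γ₀(G⁰; B)`. -/
def IsIdealA (J : Set (Ω.toLCGroupoid.UnitSpace → Ω.T)) : Prop :=
  (∀ σ ∈ J, Ω.IsA σ) ∧
  ((fun u => Ω.bzero u.1) ∈ J) ∧
  (∀ σ ∈ J, ∀ τ ∈ J, (fun u => Ω.badd (σ u) (τ u)) ∈ J) ∧
  (∀ c : ℂ, ∀ σ ∈ J, (fun u => Ω.bsmul c (σ u)) ∈ J) ∧
  (∀ σ ∈ J, ∀ τ, Ω.IsA τ →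
    (fun u => Ω.bmul (σ u) (τ u)) ∈ J ∧ (fun u => Ω.bmul (τ u) (σ u)) ∈ J) ∧
  (∀ σ, Ω.IsA σ →
    (∀ ε : ℝ, 0 < ε → ∃ τ ∈ J, ∀ u, Ω.bnorm (Ω.badd (σ u) (Ω.bsmul (-1) (τ u))) < ε) →
    σ ∈ J)

/-- The image `q_u(J) = J(u) ⊆ B(u) = A(u)` of a subset `J ⊆ A` in the fibre over
the unit `u`. -/
def fiberIm (J : Set (Ω.toLCGroupoid.UnitSpace → Ω.T)) (u : Ω.G) : Set Ω.T :=
  {t | ∃ σ ∈ J, ∃ h : Ω.rng u = u, t = σ ⟨u, h⟩}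

/-- A representation of the C*-algebra `B(u)` (`u` a unit) on a Hilbert space `H`:
a `*`-homomorphism `π` on the fibre over `u`, automatically norm-decreasing. -/
def IsFiberRep (u : Ω.G) {H : Type} [NormedAddCommGroup H] [InnerProductSpace ℂ H]
    [CompleteSpace H] (π : Ω.T → H →L[ℂ] H) : Prop :=
  (∀ a b, Ω.p a = u → Ω.p b = u → π (Ω.badd a b) = π a + π b) ∧
  (∀ (c : ℂ) a, Ω.p a = u → π (Ω.bsmul c a) = c • π a) ∧
  (∀ a b, Ω.p a = u → Ω.p b = u → π (Ω.bmul a b) = (π a).comp (π b)) ∧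
  (∀ a, Ω.p a = u → π (Ω.bstar a) = ContinuousLinearMap.adjoint (π a)) ∧
  (∀ a, Ω.p a = u → ‖π a‖ ≤ Ω.bnorm a)

/-- An irreducible representation of the C*-algebra `B(u)`: nonzero, and with no
nontrivial closed invariant subspace. -/
def IsIrredFiberRep (u : Ω.G) {H : Type} [NormedAddCommGroup H]
    [InnerProductSpace ℂ H] [CompleteSpace H] (π : Ω.T → H →L[ℂ] H) : Prop :=
  Ω.IsFiberRep u π ∧ (∃ a, Ω.p a = u ∧ π a ≠ 0) ∧
  (∀ K : Submodule ℂ H, IsClosed (K : Set H) →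
    (∀ a, Ω.p a = u → ∀ v ∈ K, π a v ∈ K) → K = ⊥ ∨ K = ⊤)

/-- The primitive ideal space `Prim A(u)` of the C*-algebra `A(u) = B(u)` over a
unit `u`: the set of kernels of irreducible representations of `B(u)`, viewed as
subsets of the fibre over `u`. -/
def PrimFiber (u : Ω.G) : Set (Set Ω.T) :=
  {P | Ω.rng u = u ∧
    ∃ (H : Type) (iN : NormedAddCommGroup H) (iP : InnerProductSpace ℂ H)
      (iC : CompleteSpace H) (π : Ω.T → H →L[ℂ] H),
      Ω.IsIrredFiberRep u π ∧ P = {a | Ω.p a = u ∧ π a = 0}}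

/-- The Rieffel correspondence `h_x` on ideals, induced by the
`A(r(x)) – A(s(x))`-imprimitivity bimodule `B(x)`: an ideal `J ⊆ A(s(x))` is sent
to the induced ideal `⟨B(x)·J, B(x)⟩_{A(r(x))} = span{(a d) b* : a, b ∈ B(x), d ∈ J}`
(closed span) in `A(r(x))`. -/
def hIdeal (x : Ω.G) (J : Set Ω.T) : Set Ω.T :=
  Ω.closedSpan (Ω.rng x)
    {t | ∃ a b d, Ω.p a = x ∧ Ω.p b = x ∧ d ∈ J ∧ t = Ω.bmul (Ω.bmul a d) (Ω.bstar b)}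

/-- `I ⊆ A` is a `G`-invariant ideal: it is an ideal, and its hull
`{(u, P) : I(u) ⊆ P} ⊆ Prim A` is invariant under the `G`-action
`x · (s(x), P) = (r(x), h_x(P))`. -/
def GInvariant (I : Set (Ω.toLCGroupoid.UnitSpace → Ω.T)) : Prop :=
  Ω.IsIdealA I ∧
  ∀ x (P : Set Ω.T), P ∈ Ω.PrimFiber (Ω.src x) →
    Ω.fiberIm I (Ω.src x) ⊆ P → Ω.fiberIm I (Ω.rng x) ⊆ Ω.hIdeal x P

/-- The subset `B_I = {b ∈ B : b* b ∈ I(s(b))}` of the total space associated to an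
ideal `I ⊆ A`. -/
def BIset (I : Set (Ω.toLCGroupoid.UnitSpace → Ω.T)) : Set Ω.T :=
  {b | Ω.bmul (Ω.bstar b) b ∈ Ω.fiberIm I (Ω.src (Ω.p b))}

end FellBundleData

section CStarIdeals

variable {A : Type*} [NonUnitalCStarAlgebra A]

/-- A closed two-sided ideal of a `C*`-algebra, as a property of a linear subspace. -/
structure IsClosedIdeal (J : Submodule ℂ A) : Prop where
  isClosed : IsClosed (J : Set A)
  mul_mem_left : ∀ a, ∀ j ∈ J, a * j ∈ J
  mul_mem_right : ∀ a, ∀ j ∈ J, j * a ∈ J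

lemma exists_approx_unit_star_mul_self (x : A) {ε : ℝ} (hε : 0 < ε) :
    ∃ e : A, IsSelfAdjoint e ∧ ‖e‖ ≤ 1 ∧
      (∃ r : ℂ, e = r • (star x * x) - r • (star x * x * e)) ∧
      ‖star x * x - star x * x * e - e * (star x * x) + e * (star x * x) * e‖ < ε := by
  let _ := CStarAlgebra.spectralOrder A
  have := CStarAlgebra.spectralOrderedRing A
  set h := star x * x with hdef
  have hh : 0 ≤ h := star_mul_self_nonneg x
  have hs : ∀ t ∈ quasispectrum ℝ h, 0 ≤ t := quasispectrum_nonneg_of_nonneg h hh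
  have hsa : IsSelfAdjoint h := .star_mul_self x
  set n : ℝ := 2 / ε with hn
  have hn0 : 0 < n := by positivity
  let f : ℝ → ℝ := fun t => n * t * (1 + n * t)⁻¹
  have hpos : ∀ t ∈ quasispectrum ℝ h, 0 < 1 + n * t := fun t ht => by
    have := hs t ht; positivity
  have hf : ContinuousOn f (quasispectrum ℝ h) := by
    refine ContinuousOn.mul (by fun_prop) (ContinuousOn.inv₀ (by fun_prop) ?_)
    exact fun t ht => (hpos t ht).ne'
  have hf0 : f 0 = 0 := by simp [f]
  have hid : cfcₙ (fun t : ℝ => t) h = h := cfcₙ_id' ℝ h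
  have hc : ContinuousOn (fun t : ℝ => t) (quasispectrum ℝ h) := continuousOn_id
  have h1 : cfcₙ (fun t => t * f t) h = h * cfcₙ f h := by
    rw [cfcₙ_mul (fun t => t) f h hc rfl hf hf0, hid]
  have h2 : cfcₙ (fun t => f t * t) h = cfcₙ f h * h := by
    rw [cfcₙ_mul f (fun t => t) h hf hf0 hc rfl, hid]
  have h3 : cfcₙ (fun t => (f t * t) * f t) h = cfcₙ f h * h * cfcₙ f h := by
    rw [cfcₙ_mul (fun t => f t * t) f h (hf.mul hc) (by simp) hf hf0, h2]
  refine ⟨cfcₙ f h, cfcₙ_predicate f h, ?_, ⟨(n : ℂ), ?_⟩, ?_⟩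
  · refine norm_cfcₙ_le fun t ht => ?_
    have h0 := hpos t ht
    have h4 := hs t ht
    have h5 : 0 ≤ n * t := by positivity
    rw [Real.norm_of_nonneg (by positivity)]
    change n * t * (1 + n * t)⁻¹ ≤ 1
    rw [← div_eq_mul_inv, div_le_one h0]; linarith
  · have : cfcₙ f h = cfcₙ (fun t => n • t - n • (t * f t)) h := by
      refine cfcₙ_congr fun t ht => ?_
      have h0 := (hpos t ht).ne'
      simp only [f, smul_eq_mul]
      field_simp
      ring
    conv_lhs => rw [this]
    rw [cfcₙ_sub (fun t => n • t) (fun t => n • (t * f t)) h (hc.const_smul n) (by simp)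
      ((hc.mul hf).const_smul n) (by simp), cfcₙ_smul n (fun t => t) h hc rfl,
      cfcₙ_smul n (fun t => t * f t) h (hc.mul hf) (by simp), hid, h1]
    simp
  · have : h - h * cfcₙ f h - cfcₙ f h * h + cfcₙ f h * h * cfcₙ f h =
        cfcₙ (fun t => t - t * f t - f t * t + (f t * t) * f t) h := by
      rw [cfcₙ_add (fun t => t - t * f t - f t * t) (fun t => (f t * t) * f t) h
          ((hc.sub (hc.mul hf)).sub (hf.mul hc)) (by simp) ((hf.mul hc).mul hf) (by simp),
        cfcₙ_sub (fun t => t - t * f t) (fun t => f t * t) h (hc.sub (hc.mul hf)) (by simp)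
          (hf.mul hc) (by simp),
        cfcₙ_sub (fun t => t) (fun t => t * f t) h hc rfl (hc.mul hf) (by simp), hid, h1, h2, h3]
    rw [this]
    refine lt_of_le_of_lt (norm_cfcₙ_le (c := ε / 2) fun t ht => ?_) (by linarith)
    have h0 := hpos t ht
    have h4 := hs t ht
    have h5 : 0 ≤ n * t := by positivity
    have : t - t * f t - f t * t + (f t * t) * f t = t * ((1 + n * t)⁻¹) ^ 2 := by
      simp only [f]; field_simp; ring
    rw [this, Real.norm_of_nonneg (by positivity), inv_pow, ← div_eq_mul_inv,
      div_le_iff₀ (by positivity)]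
    have : ε * n = 2 := by rw [hn]; field_simp
    nlinarith [mul_nonneg hε.le (sq_nonneg (n * t))]

lemma norm_sub_mul_sq_eq (x e : A) (he : IsSelfAdjoint e) :
    ‖x - x * e‖ ^ 2 =
      ‖star x * x - star x * x * e - e * (star x * x) + e * (star x * x) * e‖ := by
  rw [sq, ← CStarRing.norm_star_mul_self]
  congr 1
  rw [star_sub, star_mul, he.star_eq]
  noncomm_ring

/-- Any `x` in a `C*`-algebra is approximated by `x * e` with `e` in the ideal generated by
`star x * x`. -/
lemma exists_norm_sub_mul_lt (x : A) {ε : ℝ} (hε : 0 < ε) :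
    ∃ e : A, IsSelfAdjoint e ∧ ‖e‖ ≤ 1 ∧
      (∃ r : ℂ, e = r • (star x * x) - r • (star x * x * e)) ∧ ‖x - x * e‖ < ε := by
  obtain ⟨e, he, he1, hr, hlt⟩ := exists_approx_unit_star_mul_self x (sq_pos_of_pos hε)
  refine ⟨e, he, he1, hr, ?_⟩
  rw [← norm_sub_mul_sq_eq x e he] at hlt
  exact lt_of_pow_lt_pow_left₀ 2 hε.le hlt

namespace IsClosedIdeal

variable {J : Submodule ℂ A}

lemma mem_of_eq_smul_sub (hJ : IsClosedIdeal J) {h e : A} (hh : h ∈ J) {r : ℂ}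
    (he : e = r • h - r • (h * e)) :
    e ∈ J := by
  rw [he]
  exact J.sub_mem (J.smul_mem _ hh) (J.smul_mem _ (hJ.mul_mem_right _ _ hh))

lemma mem_of_forall_norm_lt (hJ : IsClosedIdeal J) {x : A}
    (h : ∀ ε > 0, ∃ y ∈ J, ‖x - y‖ < ε) : x ∈ J := by
  have : x ∈ closure (J : Set A) := by
    rw [Metric.mem_closure_iff]
    intro ε hε
    obtain ⟨y, hy, hlt⟩ := h ε hε
    exact ⟨y, hy, by rwa [dist_eq_norm]⟩
  rwa [hJ.isClosed.closure_eq] at this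

lemma mem_of_star_mul_self_mem (hJ : IsClosedIdeal J) {x : A} (hx : star x * x ∈ J) : x ∈ J := by
  refine hJ.mem_of_forall_norm_lt fun ε hε => ?_
  obtain ⟨e, -, -, ⟨r, hr⟩, hlt⟩ := exists_norm_sub_mul_lt x hε
  exact ⟨x * e, hJ.mul_mem_left _ _ (hJ.mem_of_eq_smul_sub hx hr), hlt⟩

lemma exists_mem_norm_sub_mul_lt (hJ : IsClosedIdeal J) {x : A} (hx : x ∈ J) {ε : ℝ} (hε : 0 < ε) :
    ∃ e ∈ J, IsSelfAdjoint e ∧ ‖e‖ ≤ 1 ∧ ‖x - x * e‖ < ε := by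
  obtain ⟨e, he, he1, ⟨r, hr⟩, hlt⟩ := exists_norm_sub_mul_lt x hε
  exact ⟨e, hJ.mem_of_eq_smul_sub (hJ.mul_mem_left _ _ hx) hr, he, he1, hlt⟩

lemma star_mem (hJ : IsClosedIdeal J) {x : A} (hx : x ∈ J) : star x ∈ J := by
  refine hJ.mem_of_forall_norm_lt fun ε hε => ?_
  obtain ⟨e, heJ, he, -, hlt⟩ := hJ.exists_mem_norm_sub_mul_lt hx hε
  refine ⟨e * star x, hJ.mul_mem_right _ _ heJ, ?_⟩
  rwa [← norm_star, star_sub, star_mul, star_star, he.star_eq]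

lemma exists_mem_norm_sub_mul_lt' (hJ : IsClosedIdeal J) {x : A} (hx : x ∈ J) {ε : ℝ} (hε : 0 < ε) :
    ∃ e ∈ J, IsSelfAdjoint e ∧ ‖x - e * x‖ < ε := by
  obtain ⟨e, heJ, he, -, hlt⟩ := hJ.exists_mem_norm_sub_mul_lt (hJ.star_mem hx) hε
  refine ⟨e, heJ, he, ?_⟩
  rwa [← norm_star, star_sub, star_mul, he.star_eq]

/-- A closed ideal as a closed star subalgebra. -/
def toStarSubalgebra (hJ : IsClosedIdeal J) : NonUnitalStarSubalgebra ℂ A where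
  carrier := J
  add_mem' := J.add_mem
  zero_mem' := J.zero_mem
  smul_mem' c _ h := J.smul_mem c h
  mul_mem' _ hb := hJ.mul_mem_left _ _ hb
  star_mem' := hJ.star_mem

end IsClosedIdeal

variable {B : Type*} [NonUnitalCStarAlgebra B]

lemma continuous_starAlgHom (φ : A →⋆ₙₐ[ℂ] B) : Continuous φ :=
  AddMonoidHomClass.continuous_of_bound φ 1 fun a => by
    simpa using NonUnitalStarAlgHom.norm_apply_le φ a

lemma exists_selfAdjoint_lift (φ : A →⋆ₙₐ[ℂ] B) {a : A} (ha : IsSelfAdjoint a) :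
    ∃ a' : A, φ a' = φ a ∧ ‖a'‖ ≤ ‖φ a‖ := by
  have hφ : Continuous φ := continuous_starAlgHom φ
  set M := ‖φ a‖
  have hM : 0 ≤ M := norm_nonneg _
  let f : ℝ → ℝ := fun t => max (-M) (min M t)
  have hf : Continuous f := by fun_prop
  have hf0 : f 0 = 0 := by simp [f, hM]
  refine ⟨cfcₙ f a, ?_, norm_cfcₙ_le fun t _ => ?_⟩
  · rw [NonUnitalStarAlgHomClass.map_cfcₙ (S := ℂ) φ f a hf.continuousOn hf0 hφ ha (ha.map φ)]
    conv_rhs => rw [← cfcₙ_id' ℝ (φ a) (ha.map φ)]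
    refine cfcₙ_congr fun t ht => ?_
    have : ‖t‖ ≤ M := by
      simpa using NonUnitalIsometricContinuousFunctionalCalculus.norm_quasispectrum_le
        (𝕜 := ℝ) (φ a) ht (ha.map φ)
    rw [Real.norm_eq_abs, abs_le] at this
    simp [f, this.1, this.2]
  · rw [Real.norm_eq_abs, abs_le]
    exact ⟨le_max_left _ _, max_le (by linarith) (min_le_left _ _)⟩

/-- The range of a `*`-homomorphism between `C*`-algebras is closed. -/
lemma isClosed_range_starAlgHom (φ : A →⋆ₙₐ[ℂ] B) : IsClosed (Set.range φ) := by
  let g : NormedAddGroupHom A B :=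
    (AddMonoidHomClass.toAddMonoidHom φ).mkNormedAddGroupHom 1 fun a => by
      simpa using NonUnitalStarAlgHom.norm_apply_le φ a
  have hsmul (r : ℝ) (a : A) : φ (r • a) = r • φ a := by
    rw [← Complex.coe_smul, map_smul, Complex.coe_smul]
  have hsurj : g.SurjectiveOnWith g.range 2 := by
    rintro _ ⟨a, rfl⟩
    obtain ⟨a₁, h₁, h₁'⟩ := exists_selfAdjoint_lift φ (realPart a).2
    obtain ⟨a₂, h₂, h₂'⟩ := exists_selfAdjoint_lift φ (imaginaryPart a).2
    have e1 : φ (realPart a : A) = (realPart (φ a) : B) := by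
      simp [realPart_apply_coe, hsmul, map_star]
    have e2 : φ (imaginaryPart a : A) = (imaginaryPart (φ a) : B) := by
      simp [imaginaryPart_apply_coe, hsmul, map_star]
    refine ⟨a₁ + Complex.I • a₂, ?_, ?_⟩
    · change φ (a₁ + Complex.I • a₂) = φ a
      rw [map_add, map_smul, h₁, h₂, ← map_smul, ← map_add, realPart_add_I_smul_imaginaryPart]
    · change _ ≤ 2 * ‖φ a‖
      rw [e1] at h₁'
      rw [e2] at h₂'
      calc _ ≤ ‖a₁‖ + ‖Complex.I • a₂‖ := norm_add_le _ _
        _ ≤ _ := by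
          rw [norm_smul, Complex.norm_I, one_mul]
          have h3 : ‖(realPart (φ a) : B)‖ ≤ ‖φ a‖ := realPart.norm_le (φ a)
          have h4 : ‖(imaginaryPart (φ a) : B)‖ ≤ ‖φ a‖ := imaginaryPart.norm_le (φ a)
          linarith
  have hcl := controlled_closure_of_complete (by norm_num) one_pos hsurj
  refine isClosed_of_closure_subset fun b hb => ?_
  obtain ⟨a, ha, -⟩ := hcl b hb
  exact ⟨a, ha⟩

lemma IsClosedIdeal.isClosed_image {J : Submodule ℂ A} (hJ : IsClosedIdeal J)
    (φ : A →⋆ₙₐ[ℂ] B) : IsClosed (φ '' J) := by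
  have : IsClosed (hJ.toStarSubalgebra : Set A) := hJ.isClosed
  have h := isClosed_range_starAlgHom
    (φ.comp (NonUnitalStarSubalgebraClass.subtype hJ.toStarSubalgebra))
  convert h using 1
  ext b
  constructor
  · rintro ⟨a, ha, rfl⟩
    exact ⟨⟨a, ha⟩, rfl⟩
  · rintro ⟨a, rfl⟩
    exact ⟨a, a.2, rfl⟩

end CStarIdeals

section IrreducibleReps

open scoped ComplexOrder InnerProductSpace

variable {B : Type*} [CStarAlgebra B]

/-- The states of a unital `C*`-algebra vanishing on `J`, as a set of plain functions. -/
def stateSet (J : Set B) : Set (B → ℂ) :=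
  {φ | (∀ a b, φ (a + b) = φ a + φ b) ∧ (∀ (c : ℂ) a, φ (c • a) = c * φ a) ∧ φ 1 = 1 ∧
    (∀ a, ‖φ a‖ ≤ ‖a‖) ∧ (∀ a, 0 ≤ φ (star a * a)) ∧ ∀ j ∈ J, φ j = 0}

lemma isCompact_stateSet (J : Set B) : IsCompact (stateSet J) := by
  have hcl : IsClosed (stateSet J) := by
    simp only [stateSet, Set.ofPred_and, Set.ofPred_forall]
    refine .inter (isClosed_iInter fun a => isClosed_iInter fun b => ?_) <|
      .inter (isClosed_iInter fun r => isClosed_iInter fun a => ?_) <| .inter ?_ <|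
      .inter (isClosed_iInter fun a => ?_) <| .inter (isClosed_iInter fun a => ?_) <|
      isClosed_iInter fun j => isClosed_iInter fun _ => ?_
    · exact isClosed_eq (continuous_apply _)
        (show Continuous fun φ : B → ℂ => φ a + φ b by fun_prop)
    · exact isClosed_eq (continuous_apply _) (show Continuous fun φ : B → ℂ => r * φ a by fun_prop)
    · exact isClosed_eq (continuous_apply _) continuous_const
    · exact isClosed_le (continuous_apply _).norm continuous_const
    · exact isClosed_le continuous_const (continuous_apply _)
    · exact isClosed_eq (continuous_apply _) continuous_const
  refine (isCompact_univ_pi fun a : B => isCompact_closedBall (0 : ℂ) ‖a‖).of_isClosed_subset hcl ?_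
  intro φ hφ a _
  simpa using hφ.2.2.2.1 a

section VectorState

variable {H : Type*} [NormedAddCommGroup H] [InnerProductSpace ℂ H] [CompleteSpace H]

lemma norm_sq_apply_eq (π : B →⋆ₐ[ℂ] (H →L[ℂ] H)) (a : B) (v : H) :
    ⟪v, π (star a * a) v⟫_ℂ = ((‖π a v‖ ^ 2 : ℝ) : ℂ) := by
  rw [map_mul, map_star, ContinuousLinearMap.star_eq_adjoint, mul_apply_eq_comp,
    ContinuousLinearMap.adjoint_inner_right, inner_self_eq_norm_sq_to_K]
  norm_cast

lemma vectorState_mem_stateSet {J : Set B} (π : B →⋆ₐ[ℂ] (H →L[ℂ] H)) (hJ : ∀ j ∈ J, π j = 0)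
    {v : H} (hv : ‖v‖ = 1) : (fun a => ⟪v, π a v⟫_ℂ) ∈ stateSet J := by
  refine ⟨fun a b => by simp, fun c a => by simp, ?_, fun a => ?_,
    fun a => ?_, fun j hj => by simp [hJ j hj]⟩
  · simp [inner_self_eq_norm_sq_to_K, hv]
  · calc _ ≤ ‖v‖ * ‖π a v‖ := norm_inner_le_norm _ _
      _ ≤ ‖v‖ * (‖π a‖ * ‖v‖) := by gcongr; exact (π a).le_opNorm v
      _ ≤ ‖a‖ := by
        rw [hv]; simpa using NonUnitalStarAlgHom.norm_apply_le π a
  · change 0 ≤ ⟪v, π (star a * a) v⟫_ℂ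
    rw [norm_sq_apply_eq]
    exact Complex.zero_le_real.mpr (sq_nonneg _)

end VectorState

lemma exists_cyclic_rep {B : Type} [CStarAlgebra B] (f : B →ₗ[ℂ] ℂ)
    (hf : ∀ a, 0 ≤ f (star a * a)) :
    ∃ (H : Type) (_ : NormedAddCommGroup H) (_ : InnerProductSpace ℂ H) (_ : CompleteSpace H)
      (π : B →⋆ₐ[ℂ] (H →L[ℂ] H)) (ξ : H), (∀ a, f a = ⟪ξ, π a ξ⟫_ℂ) ∧
        DenseRange fun a => π a ξ := by
  let _ := CStarAlgebra.spectralOrder B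
  have := CStarAlgebra.spectralOrderedRing B
  let F : B →ₚ[ℂ] ℂ := .mk₀ f fun x hx => by
    obtain ⟨a, rfl⟩ := CStarAlgebra.nonneg_iff_eq_star_mul_self.mp hx
    exact hf a
  have key (a : B) : F.gnsStarAlgHom a (F.toPreGNS 1 : F.PreGNS) = (F.toPreGNS a : F.PreGNS) := by
    rw [PositiveLinearMap.gnsStarAlgHom_apply]
    erw [PositiveLinearMap.gnsNonUnitalStarAlgHom_apply_coe]
    simp
  refine ⟨F.GNS, inferInstance, inferInstance, inferInstance, F.gnsStarAlgHom,
    ((F.toPreGNS 1 : F.PreGNS) : F.GNS), fun a => ?_, ?_⟩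
  · rw [key, UniformSpace.Completion.inner_coe, PositiveLinearMap.preGNS_inner_def]
    simp only [PositiveLinearMap.ofPreGNS_toPreGNS, star_one, one_mul]
    rfl
  · have : (fun a => F.gnsStarAlgHom a (F.toPreGNS 1 : F.PreGNS)) =
        ((↑) : F.PreGNS → F.GNS) ∘ F.toPreGNS := funext key
    rw [this]
    exact UniformSpace.Completion.denseRange_coe.comp F.toPreGNS.surjective.denseRange
      (UniformSpace.Completion.continuous_coe _)

/-- A positive functional vanishing on a closed ideal and separating it from `star c * c`. -/
lemma exists_positive_functional {J : Submodule ℂ B} (hJ : IsClosedIdeal J) {c : B} (hc : c ∉ J) :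
    ∃ f : B →ₗ[ℂ] ℂ, (∀ a, 0 ≤ f (star a * a)) ∧ (∀ j ∈ J, f j = 0) ∧
      f (star c * c) ≠ 0 := by
  let _ := CStarAlgebra.spectralOrder B
  have := CStarAlgebra.spectralOrderedRing B
  set h := star c * c
  let K : Set B := {x | ∃ p, 0 ≤ p ∧ ∃ j ∈ J, x = p + j}
  have hK : Convex ℝ K := by
    rintro _ ⟨p, hp, j, hj, rfl⟩ _ ⟨q, hq, k, hk, rfl⟩ s t hs ht -
    refine ⟨s • p + t • q, add_nonneg (smul_nonneg hs hp) (smul_nonneg ht hq), s • j + t • k,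
      J.add_mem (J.smul_mem (s : ℂ) hj) (J.smul_mem (t : ℂ) hk), ?_⟩
    simp only [smul_add]
    abel
  have hnot : -h ∉ closure K := by
    intro hmem
    refine hc (hJ.mem_of_forall_norm_lt fun ε hε => ?_)
    have hε2 : 0 < ε ^ 2 / 8 := by positivity
    obtain ⟨_, ⟨p, hp, j, hj, rfl⟩, hlt⟩ := Metric.mem_closure_iff.mp hmem _ hε2
    obtain ⟨e, heJ, he, he1, hje⟩ := hJ.exists_mem_norm_sub_mul_lt hj hε2
    refine ⟨c * e, hJ.mul_mem_left _ _ heJ, ?_⟩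
    have hd : ‖h + p + j‖ < ε ^ 2 / 8 := by
      rw [dist_eq_norm, ← norm_neg] at hlt
      rwa [show h + p + j = -(-h - (p + j)) by abel]
    set g := 1 - e with hg
    have hgs : star g = g := by simp [g, he.star_eq]
    have hg2 : ‖g‖ ≤ 2 := by
      have h1 : ‖(1 : B)‖ ≤ 1 := by
        nontriviality B
        exact CStarRing.norm_one.le
      calc ‖g‖ ≤ ‖(1 : B)‖ + ‖e‖ := norm_sub_le _ _
        _ ≤ 2 := by linarith
    have e1 : star g * h * g ≤ star g * (h + p) * g := by
      exact star_left_conjugate_le_conjugate (by simpa using hp) g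
    have e2 : ‖star g * h * g‖ = ‖c - c * e‖ ^ 2 := by
      rw [sq, ← CStarRing.norm_star_mul_self]
      congr 1
      simp only [g, h, star_sub, star_mul, star_one]
      noncomm_ring
    have e3 : star g * (h + p) * g = g * (h + p + j) * g - g * (j - j * e) := by
      rw [hgs]; simp only [g]; noncomm_ring
    have e4 : ‖star g * h * g‖ ≤ ‖star g * (h + p) * g‖ :=
      CStarAlgebra.norm_le_norm_of_nonneg_of_le
        (star_left_conjugate_nonneg (star_mul_self_nonneg c) g) e1
    have e5 : ‖star g * (h + p) * g‖ < ε ^ 2 := by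
      rw [e3]
      calc _ ≤ ‖g * (h + p + j) * g‖ + ‖g * (j - j * e)‖ := norm_sub_le _ _
        _ ≤ ‖g‖ * ‖h + p + j‖ * ‖g‖ + ‖g‖ * ‖j - j * e‖ := by
          gcongr
          · exact (norm_mul_le _ _).trans (by gcongr; exact norm_mul_le _ _)
          · exact norm_mul_le _ _
        _ ≤ 2 * ‖h + p + j‖ * 2 + 2 * ‖j - j * e‖ := by gcongr
        _ < ε ^ 2 := by linarith
    rw [e2] at e4
    exact lt_of_pow_lt_pow_left₀ 2 hε.le (e4.trans_lt e5)
  obtain ⟨f, u, hfu, hu⟩ := RCLike.geometric_hahn_banach_point_closed (𝕜 := ℂ) hK.closure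
    isClosed_closure hnot
  have hu0 : u < 0 := by simpa using hu 0 (subset_closure ⟨0, le_rfl, 0, J.zero_mem, by simp⟩)
  have hcone {x : B} (hx : ∀ s : ℝ, 0 ≤ s → (s : ℂ) • x ∈ K) : 0 ≤ (f x).re := by
    by_contra! hneg
    have h1 := hu _ (subset_closure (hx (u / (f x).re) (div_nonneg_of_nonpos hu0.le hneg.le)))
    rw [map_smul] at h1
    simp at h1
    rw [div_mul_cancel₀ _ hneg.ne] at h1
    exact lt_irrefl _ h1
  have hpos {p : B} (hp : 0 ≤ p) : 0 ≤ (f p).re := hcone fun s hs =>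
    ⟨(s : ℂ) • p, by rw [Complex.coe_smul]; exact smul_nonneg hs hp, 0, J.zero_mem, by simp⟩
  have hJre {j : B} (hj : j ∈ J) : (f j).re = 0 := by
    have h1 : ∀ j ∈ J, 0 ≤ (f j).re := fun j hj =>
      hcone fun s _ => ⟨0, le_rfl, (s : ℂ) • j, J.smul_mem _ hj, by simp⟩
    have h2 := h1 (-j) (J.neg_mem hj)
    simp at h2
    exact le_antisymm h2 (h1 j hj)
  have hJ0 {j : B} (hj : j ∈ J) : f j = 0 := by
    refine Complex.ext (hJre hj) ?_
    have := hJre (J.smul_mem Complex.I hj)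
    simpa using this
  have hh : 0 < (f h).re := by
    have : (f (-h)).re < 0 := hfu.trans hu0
    simpa using this
  let F : B →ₗ[ℂ] ℂ :=
    { toFun := fun a => f a + starRingEnd ℂ (f (star a))
      map_add' := fun a b => by simp; ring
      map_smul' := fun r a => by simp; ring }
  have hF {a : B} (ha : IsSelfAdjoint a) : F a = ((2 * (f a).re : ℝ) : ℂ) := by
    change f a + starRingEnd ℂ (f (star a)) = _
    rw [ha.star_eq, Complex.add_conj]
  refine ⟨F, fun a => ?_, fun j hj => ?_, ?_⟩
  · rw [hF (.star_mul_self a)]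
    exact_mod_cast mul_nonneg zero_le_two (hpos (star_mul_self_nonneg a))
  · change f j + starRingEnd ℂ (f (star j)) = 0
    rw [hJ0 hj, hJ0 (hJ.star_mem hj)]
    simp
  · rw [hF (.star_mul_self c)]
    exact_mod_cast (by positivity : 2 * (f h).re ≠ 0)

lemma rep_eq_zero_of_functional {H : Type*} [NormedAddCommGroup H] [InnerProductSpace ℂ H]
    [CompleteSpace H] {J : Submodule ℂ B} (hJ : IsClosedIdeal J) (π : B →⋆ₐ[ℂ] (H →L[ℂ] H)) (ξ : H)
    (hξ : DenseRange fun a => π a ξ) (h : ∀ j ∈ J, ⟪ξ, π j ξ⟫_ℂ = 0) : ∀ j ∈ J, π j = 0 := by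
  intro j hj
  have h0 (a : B) : π j (π a ξ) = 0 := by
    have h1 := norm_sq_apply_eq π (j * a) ξ
    rw [h _ (hJ.mul_mem_left _ _ (hJ.mul_mem_right _ _ hj))] at h1
    have h2 : ‖π (j * a) ξ‖ = 0 := by
      have : ‖π (j * a) ξ‖ ^ 2 = 0 := by exact_mod_cast h1.symm
      simpa using this
    simpa [map_mul] using h2
  ext v
  exact congrFun (hξ.equalizer (π j).continuous continuous_zero (funext h0)) v

/-- The cyclic representation of an extreme point of the set of states vanishing on `J` is
irreducible. -/
lemma irreducible_of_mem_extremePoints {H : Type*} [NormedAddCommGroup H] [InnerProductSpace ℂ H]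
    [CompleteSpace H] {J : Set B} (π : B →⋆ₐ[ℂ] (H →L[ℂ] H)) (hπ : ∀ j ∈ J, π j = 0) (ξ : H)
    (hξ : DenseRange fun a => π a ξ)
    (hext : (fun a => ⟪ξ, π a ξ⟫_ℂ) ∈ (stateSet J).extremePoints ℝ)
    (K : Submodule ℂ H) (hK : IsClosed (K : Set H)) (hinv : ∀ a, ∀ v ∈ K, π a v ∈ K) :
    K = ⊥ ∨ K = ⊤ := by
  have : CompleteSpace K := hK.completeSpace_coe
  obtain ⟨hmem, hext⟩ := mem_extremePoints.mp hext
  have hξ1 : ‖ξ‖ ^ 2 = 1 := by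
    have := hmem.2.2.1
    simp only [map_one, one_apply_eq_self, inner_self_eq_norm_sq_to_K] at this
    exact Complex.ofReal_injective (by push_cast; exact this)
  have hinv' : ∀ a, ∀ v ∈ Kᗮ, π a v ∈ Kᗮ := by
    intro a v hv w hw
    have := hv _ (hinv (star a) w hw)
    rwa [map_star, ContinuousLinearMap.star_eq_adjoint,
      ContinuousLinearMap.adjoint_inner_left] at this
  have htop {L : Submodule ℂ H} (hL : IsClosed (L : Set H)) (hLinv : ∀ a, ∀ v ∈ L, π a v ∈ L)
      (hmem : ξ ∈ L) : L = ⊤ := by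
    have h1 : Set.range (fun a => π a ξ) ⊆ L := by
      rintro _ ⟨a, rfl⟩
      exact hLinv a ξ hmem
    have h2 := closure_minimal h1 hL
    rw [hξ.closure_range] at h2
    exact eq_top_iff.mpr fun v _ => h2 (Set.mem_univ v)
  obtain ⟨v, hv, w, hw, hvw⟩ := K.exists_add_mem_mem_orthogonal ξ
  by_cases hv0 : v = 0
  · left
    have h1 : Kᗮ = ⊤ := htop K.isClosed_orthogonal hinv' (by rw [hvw, hv0, zero_add]; exact hw)
    rwa [Submodule.orthogonal_eq_top_iff] at h1
  by_cases hw0 : w = 0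
  · right
    exact htop hK hinv (by rw [hvw, hw0, add_zero]; exact hv)
  exfalso
  have hvwo (x y : H) (hx : x ∈ K) (hy : y ∈ Kᗮ) : ⟪x, y⟫_ℂ = 0 := hy x hx
  have hwvo (x y : H) (hx : x ∈ K) (hy : y ∈ Kᗮ) : ⟪y, x⟫_ℂ = 0 :=
    (Submodule.mem_orthogonal' K y).mp hy x hx
  have hnorm : ‖v‖ ^ 2 + ‖w‖ ^ 2 = 1 := by
    have h1 := norm_add_sq_eq_norm_sq_add_norm_sq_of_inner_eq_zero v w (hvwo v w hv hw)
    rw [← hvw] at h1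
    nlinarith
  have hstate {z : H} (hz : z ≠ 0) :
      (fun a => ⟪(‖z‖⁻¹ : ℂ) • z, π a ((‖z‖⁻¹ : ℂ) • z)⟫_ℂ) ∈ stateSet J := by
    refine vectorState_mem_stateSet π hπ ?_
    rw [norm_smul, norm_inv, Complex.norm_real, norm_norm, inv_mul_cancel₀ (norm_ne_zero_iff.mpr hz)]
  have hval {z : H} (hz : z ≠ 0) (a : B) :
      ((‖z‖ ^ 2 : ℝ) : ℂ) * ⟪(‖z‖⁻¹ : ℂ) • z, π a ((‖z‖⁻¹ : ℂ) • z)⟫_ℂ = ⟪z, π a z⟫_ℂ := by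
    have : (‖z‖ : ℂ) ≠ 0 := by exact_mod_cast norm_ne_zero_iff.mpr hz
    rw [map_smul, inner_smul_left, inner_smul_right, map_inv₀, Complex.conj_ofReal]
    push_cast
    field_simp
  have hsplit (a : B) : ⟪ξ, π a ξ⟫_ℂ = ⟪v, π a v⟫_ℂ + ⟪w, π a w⟫_ℂ := by
    conv_lhs => rw [hvw]
    rw [map_add, inner_add_left, inner_add_right, inner_add_right,
      hvwo v _ hv (hinv' a w hw), hwvo _ w (hinv a v hv) hw]
    ring
  have heq := (hext _ (hstate hv0) _ (hstate hw0) ⟨‖v‖ ^ 2, ‖w‖ ^ 2, by positivity, by positivity,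
    hnorm, by
      funext a
      simp only [Pi.add_apply, Pi.smul_apply, Complex.real_smul]
      rw [hval hv0, hval hw0, hsplit]⟩).1
  have hv_eq : v = ((‖v‖ ^ 2 : ℝ) : ℂ) • ξ := by
    have h1 (a : B) : ⟪v - ((‖v‖ ^ 2 : ℝ) : ℂ) • ξ, π a ξ⟫_ℂ = 0 := by
      have h2 := hval hv0 a
      have h3 := congrFun heq a
      rw [h3] at h2
      rw [inner_sub_left, inner_smul_left, Complex.conj_ofReal, h2]
      conv_lhs => rw [hvw]
      rw [map_add, inner_add_right, hvwo v _ hv (hinv' a w hw)]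
      ring
    have h2 := hξ.equalizer (g := fun x => ⟪v - ((‖v‖ ^ 2 : ℝ) : ℂ) • ξ, x⟫_ℂ) (h := 0)
      (by fun_prop) continuous_zero (funext h1)
    exact sub_eq_zero.mp (inner_self_eq_zero.mp (congrFun h2 _))
  have hwK : w ∈ K := by
    have hξK : ξ ∈ K := by
      have hne : ((‖v‖ ^ 2 : ℝ) : ℂ) ≠ 0 := by
        exact_mod_cast pow_ne_zero 2 (norm_ne_zero_iff.mpr hv0)
      rw [hv_eq] at hv
      exact (K.smul_mem_iff hne).mp hv
    have : w = ξ - v := by rw [hvw]; abel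
    rw [this]
    exact K.sub_mem hξK hv
  exact hw0 (inner_self_eq_zero.mp (hvwo w w hwK hw))

/-- Every closed ideal of a unital `C*`-algebra is an intersection of kernels of irreducible
representations. -/
lemma exists_irreducible_rep_unital {B : Type} [CStarAlgebra B] {J : Submodule ℂ B}
    (hJ : IsClosedIdeal J) {c : B} (hc : c ∉ J) :
    ∃ (H : Type) (_ : NormedAddCommGroup H) (_ : InnerProductSpace ℂ H) (_ : CompleteSpace H)
      (π : B →⋆ₐ[ℂ] (H →L[ℂ] H)), (∀ j ∈ J, π j = 0) ∧ π c ≠ 0 ∧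
        ∀ K : Submodule ℂ H, IsClosed (K : Set H) → (∀ a, ∀ v ∈ K, π a v ∈ K) →
          K = ⊥ ∨ K = ⊤ := by
  set h := star c * c with hh
  obtain ⟨φ₀, hφ₀, hφ₀h⟩ : ∃ φ ∈ stateSet (J : Set B), 0 < (φ h).re := by
    obtain ⟨f, hf, hfJ, hfc⟩ := exists_positive_functional hJ hc
    obtain ⟨H, _, _, _, π, ξ, hπ, hξ⟩ := exists_cyclic_rep f hf
    have hξ0 : ξ ≠ 0 := by
      rintro rfl
      exact hfc (by simp [hπ])
    have hπJ := rep_eq_zero_of_functional hJ π ξ hξ fun j hj => by rw [← hπ, hfJ j hj]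
    refine ⟨_, vectorState_mem_stateSet π hπJ (v := (‖ξ‖⁻¹ : ℂ) • ξ) ?_, ?_⟩
    · rw [norm_smul, norm_inv, Complex.norm_real, norm_norm,
        inv_mul_cancel₀ (norm_ne_zero_iff.mpr hξ0)]
    · change 0 < (⟪_, π (star c * c) _⟫_ℂ).re
      rw [norm_sq_apply_eq, Complex.ofReal_re, map_smul, norm_smul, norm_inv, Complex.norm_real,
        norm_norm]
      have : π c ξ ≠ 0 := by
        intro h0
        refine hfc ?_
        rw [hπ, norm_sq_apply_eq, h0]
        simp
      have := norm_pos_iff.mpr this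
      have := norm_pos_iff.mpr hξ0
      positivity
  have hcont : Continuous fun φ : B → ℂ => (φ h).re :=
    Complex.continuous_re.comp (continuous_apply h)
  obtain ⟨φ₁, hφ₁, hmax⟩ := (isCompact_stateSet (J : Set B)).exists_isMaxOn ⟨φ₀, hφ₀⟩
    hcont.continuousOn
  let F : Set (B → ℂ) := stateSet (J : Set B) ∩ {φ | (φ h).re = (φ₁ h).re}
  have hF : IsCompact F :=
    (isCompact_stateSet _).inter_right (isClosed_eq hcont continuous_const)
  obtain ⟨φ, hφ⟩ := hF.extremePoints_nonempty ⟨φ₁, hφ₁, rfl⟩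
  have hφext : φ ∈ (stateSet (J : Set B)).extremePoints ℝ := by
    obtain ⟨hφF, hφ⟩ := mem_extremePoints.mp hφ
    refine mem_extremePoints.mpr ⟨hφF.1, fun ψ hψ χ hχ hseg => ?_⟩
    obtain ⟨s, t, hs, ht, hst, heq⟩ := id hseg
    have h1 : (ψ h).re ≤ (φ₁ h).re := hmax hψ
    have h2 : (χ h).re ≤ (φ₁ h).re := hmax hχ
    have h3 : s * (ψ h).re + t * (χ h).re = (φ₁ h).re := by
      rw [← hφF.2, ← heq]
      simp
    have h4 : (ψ h).re = (φ₁ h).re := by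
      by_contra hne
      have := mul_lt_mul_of_pos_left (lt_of_le_of_ne h1 hne) hs
      have := mul_le_mul_of_nonneg_left h2 ht.le
      have : (s + t) * (φ₁ h).re = (φ₁ h).re := by rw [hst, one_mul]
      nlinarith
    have h5 : (χ h).re = (φ₁ h).re := by
      by_contra hne
      have := mul_lt_mul_of_pos_left (lt_of_le_of_ne h2 hne) ht
      have := mul_le_mul_of_nonneg_left h1 hs.le
      have : (s + t) * (φ₁ h).re = (φ₁ h).re := by rw [hst, one_mul]
      nlinarith
    exact hφ ψ ⟨hψ, h4⟩ χ ⟨hχ, h5⟩ hseg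
  have hφS := hφext.1
  have hφh : φ h ≠ 0 := by
    have h1 : (φ h).re = (φ₁ h).re := hφ.1.2
    have h2 : (φ₀ h).re ≤ (φ₁ h).re := hmax hφ₀
    intro h0
    rw [h0] at h1
    simp at h1
    linarith
  let f : B →ₗ[ℂ] ℂ := { toFun := φ, map_add' := hφS.1, map_smul' := hφS.2.1 }
  obtain ⟨H, _, _, _, π, ξ, hπ, hξ⟩ := exists_cyclic_rep f hφS.2.2.2.2.1
  have hπJ := rep_eq_zero_of_functional hJ π ξ hξ fun j hj => by
    rw [← hπ]; exact hφS.2.2.2.2.2 j hj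
  have hφeq : φ = fun a => ⟪ξ, π a ξ⟫_ℂ := funext hπ
  refine ⟨H, _, _, _, π, hπJ, ?_, fun K hK hinv =>
    irreducible_of_mem_extremePoints π hπJ ξ hξ (hφeq ▸ hφext) K hK hinv⟩
  intro h0
  refine hφh ?_
  rw [hφeq]
  simp [h, h0]

/-- Every closed ideal of a `C*`-algebra is an intersection of kernels of irreducible
representations. -/
lemma exists_irreducible_rep {A : Type} [NonUnitalCStarAlgebra A] {J : Submodule ℂ A}
    (hJ : IsClosedIdeal J) {c : A} (hc : c ∉ J) :
    ∃ (H : Type) (_ : NormedAddCommGroup H) (_ : InnerProductSpace ℂ H) (_ : CompleteSpace H)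
      (π : A →⋆ₙₐ[ℂ] (H →L[ℂ] H)), (∀ j ∈ J, π j = 0) ∧ π c ≠ 0 ∧
        ∀ K : Submodule ℂ H, IsClosed (K : Set H) → (∀ a, ∀ v ∈ K, π a v ∈ K) →
          K = ⊥ ∨ K = ⊤ := by
  let J' : Submodule ℂ (Unitization ℂ A) := J.map (Unitization.inrHom ℂ ℂ A)
  have hmem (a : A) : (a : Unitization ℂ A) ∈ J' ↔ a ∈ J := by
    constructor
    · rintro ⟨b, hb, hab⟩
      rwa [← Unitization.inr_injective hab]
    · exact fun h => ⟨a, h, rfl⟩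
  have hJ' : IsClosedIdeal J' := by
    refine ⟨?_, ?_, ?_⟩
    · exact (Unitization.isometry_inr (𝕜 := ℂ) (A := A)).isClosedEmbedding.isClosedMap _ hJ.isClosed
    · rintro a _ ⟨j, hj, rfl⟩
      induction a with
      | inl_add_inr r a =>
        refine ⟨r • j + a * j, J.add_mem (J.smul_mem r hj) (hJ.mul_mem_left a j hj), ?_⟩
        simp [add_mul, Unitization.inl_mul_inr]
    · rintro a _ ⟨j, hj, rfl⟩
      induction a with
      | inl_add_inr r a =>
        refine ⟨r • j + j * a, J.add_mem (J.smul_mem r hj) (hJ.mul_mem_right a j hj), ?_⟩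
        simp [mul_add, Unitization.inr_mul_inl]
  obtain ⟨H, _, _, _, π, hπJ, hπc, hirr⟩ :=
    exists_irreducible_rep_unital hJ' (c := (c : Unitization ℂ A)) (by rwa [hmem])
  refine ⟨H, _, _, _,
    (π : Unitization ℂ A →⋆ₙₐ[ℂ] (H →L[ℂ] H)).comp (Unitization.inrNonUnitalStarAlgHom ℂ A),
    fun j hj => hπJ _ ((hmem j).mpr hj), hπc, fun K hK hinv => hirr K hK fun a v hv => ?_⟩
  induction a with
  | inl_add_inr r a =>
    have : π (Unitization.inl r + (a : Unitization ℂ A)) v = r • v + π (a : Unitization ℂ A) v := by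
      have h1 : (Unitization.inl r : Unitization ℂ A) = algebraMap ℂ _ r := rfl
      rw [map_add, h1, AlgHomClass.commutes]
      simp [Algebra.algebraMap_eq_smul_one]
    rw [this]
    exact K.add_mem (K.smul_mem r hv) (hinv a v hv)

end IrreducibleReps

namespace FellBundleData

variable {Ω : FellBundleData}

attribute [instance] LCGroupoid.t2G LCGroupoid.lcG

/-- The fibre of the bundle over `x`, as a Banach space. -/
@[ext]
structure Fib (Ω : FellBundleData) (x : Ω.G) where
  val : Ω.T
  p_val : Ω.p val = x

namespace Fib

variable {x y z : Ω.G}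

lemma val_injective : Function.Injective (val : Fib Ω x → Ω.T) := fun _ _ => Fib.ext

instance : Zero (Fib Ω x) := ⟨⟨Ω.bzero x, Ω.p_bzero x⟩⟩
instance : Add (Fib Ω x) :=
  ⟨fun a b => ⟨Ω.badd a.val b.val, (Ω.p_badd _ _ (a.p_val.trans b.p_val.symm)).trans a.p_val⟩⟩
instance : SMul ℂ (Fib Ω x) := ⟨fun c a => ⟨Ω.bsmul c a.val, (Ω.p_bsmul _ _).trans a.p_val⟩⟩
instance : Neg (Fib Ω x) := ⟨fun a => (-1 : ℂ) • a⟩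
instance : Norm (Fib Ω x) := ⟨fun a => Ω.bnorm a.val⟩

@[simp] lemma zero_val : (0 : Fib Ω x).val = Ω.bzero x := rfl
@[simp] lemma add_val (a b : Fib Ω x) : (a + b).val = Ω.badd a.val b.val := rfl
@[simp] lemma smul_val (c : ℂ) (a : Fib Ω x) : (c • a).val = Ω.bsmul c a.val := rfl
lemma norm_def (a : Fib Ω x) : ‖a‖ = Ω.bnorm a.val := rfl

instance : AddCommGroup (Fib Ω x) where
  add_assoc a b c := Fib.ext <| Ω.badd_assoc _ _ _ (a.p_val.trans b.p_val.symm)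
    (b.p_val.trans c.p_val.symm)
  add_comm a b := Fib.ext <| Ω.badd_comm _ _ (a.p_val.trans b.p_val.symm)
  zero_add a := Fib.ext <| by simpa [a.p_val] using Ω.bzero_badd a.val
  add_zero a := Fib.ext <| by
    change Ω.badd a.val (Ω.bzero x) = a.val
    rw [Ω.badd_comm _ _ (by rw [a.p_val, Ω.p_bzero])]
    simpa [a.p_val] using Ω.bzero_badd a.val
  neg_add_cancel a := Fib.ext <| by
    change Ω.badd (Ω.bsmul (-1) a.val) a.val = Ω.bzero x
    rw [Ω.badd_comm _ _ (Ω.p_bsmul _ _), Ω.badd_neg, a.p_val]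
  nsmul := nsmulRec
  zsmul := zsmulRec

instance : Module ℂ (Fib Ω x) where
  one_smul a := Fib.ext <| Ω.one_bsmul _
  mul_smul c d a := Fib.ext <| Ω.mul_bsmul _ _ _
  smul_zero c := Fib.ext <| Ω.bsmul_bzero _ _
  smul_add c a b := Fib.ext <| Ω.bsmul_badd _ _ _ (a.p_val.trans b.p_val.symm)
  add_smul c d a := Fib.ext <| Ω.add_bsmul _ _ _
  zero_smul a := Fib.ext <| by simpa [a.p_val] using Ω.zero_bsmul a.val

lemma core : NormedSpace.Core ℂ (Fib Ω x) where
  norm_nonneg a := Ω.bnorm_nonneg _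
  norm_smul c a := Ω.bnorm_bsmul _ _
  norm_triangle a b := Ω.bnorm_badd_le _ _ (a.p_val.trans b.p_val.symm)
  norm_eq_zero_iff a := by
    rw [norm_def, Ω.bnorm_eq_zero, a.p_val, Fib.ext_iff]
    rfl

instance : NormedAddCommGroup (Fib Ω x) := .ofCore core
instance : NormedSpace ℂ (Fib Ω x) := .ofCore core

@[simp] lemma sub_val (a b : Fib Ω x) : (a - b).val = Ω.badd a.val (Ω.bsmul (-1) b.val) := by
  rw [sub_eq_add_neg]
  rfl

lemma norm_sub_def (a b : Fib Ω x) :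
    ‖a - b‖ = Ω.bnorm (Ω.badd a.val (Ω.bsmul (-1) b.val)) := by
  rw [norm_def, sub_val]

lemma isInducing_val : Topology.IsInducing (val : Fib Ω x → Ω.T) := by
  refine Topology.isInducing_iff_nhds.mpr fun a => le_antisymm ?_ ?_
  · rw [← map_le_iff_le_comap]
    intro U hU
    obtain ⟨ε, hε, h⟩ := Ω.norm_nbhd_fiber a.val U hU
    refine mem_map.mpr (mem_of_superset (Metric.ball_mem_nhds a hε) fun c hc => ?_)
    exact h _ (c.p_val.trans a.p_val.symm) (by rwa [← norm_sub_def, ← dist_eq_norm])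
  · refine (Metric.nhds_basis_ball.ge_iff).mpr fun ε hε => ?_
    obtain ⟨U, hU, h⟩ := Ω.fiber_nbhd_norm a.val ε hε
    refine mem_comap.mpr ⟨U, hU, fun c hc => ?_⟩
    rw [Metric.mem_ball, dist_eq_norm, norm_sub_def]
    exact h _ hc (c.p_val.trans a.p_val.symm)

lemma range_val : Set.range (val : Fib Ω x → Ω.T) = Ω.fiberSet x :=
  Set.ext fun b => ⟨fun ⟨a, h⟩ => h ▸ a.p_val, fun h => ⟨⟨b, h⟩, rfl⟩⟩

lemma isClosedEmbedding_val : Topology.IsClosedEmbedding (val : Fib Ω x → Ω.T) where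
  toIsInducing := isInducing_val
  injective := val_injective
  isClosed_range := by
    rw [range_val]
    exact isClosed_eq Ω.p_cont continuous_const

lemma continuous_val : Continuous (val : Fib Ω x → Ω.T) := isInducing_val.continuous

instance : CompleteSpace (Fib Ω x) := by
  refine Metric.complete_of_cauchySeq_tendsto fun u hu => ?_
  obtain ⟨L, hL, h⟩ := Ω.fiber_complete x (fun n => (u n).val) (fun n => (u n).p_val) fun ε hε => by
    obtain ⟨N, hN⟩ := Metric.cauchySeq_iff.mp hu ε hε
    exact ⟨N, fun m n hm hn => by rw [← norm_sub_def, ← dist_eq_norm]; exact hN m hm n hn⟩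
  refine ⟨⟨L, hL⟩, tendsto_iff_norm_sub_tendsto_zero.mpr ?_⟩
  simpa only [norm_sub_def] using h

/-- The product of the bundle, from two fibres to a third one. -/
def fmul (h : Ω.src x = Ω.rng y) (hz : Ω.gmul x y = z) (a : Fib Ω x) (b : Fib Ω y) : Fib Ω z :=
  ⟨Ω.bmul a.val b.val, by
    rw [Ω.p_bmul _ _ (by rw [a.p_val, b.p_val, h]), a.p_val, b.p_val, hz]⟩

/-- The involution of the bundle, from one fibre to another. -/
def fstar (h : Ω.ginv x = y) (a : Fib Ω x) : Fib Ω y :=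
  ⟨Ω.bstar a.val, by rw [Ω.p_bstar, a.p_val, h]⟩

section

variable (h : Ω.src x = Ω.rng y) (hz : Ω.gmul x y = z)

@[simp] lemma fmul_val (a : Fib Ω x) (b : Fib Ω y) : (fmul h hz a b).val = Ω.bmul a.val b.val := rfl

lemma fmul_add (a : Fib Ω x) (b c : Fib Ω y) :
    fmul h hz a (b + c) = fmul h hz a b + fmul h hz a c :=
  Fib.ext <| Ω.badd_bmul _ _ _ (b.p_val.trans c.p_val.symm) (by rw [a.p_val, b.p_val, h])

lemma add_fmul (a b : Fib Ω x) (c : Fib Ω y) :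
    fmul h hz (a + b) c = fmul h hz a c + fmul h hz b c :=
  Fib.ext <| Ω.bmul_badd _ _ _ (a.p_val.trans b.p_val.symm) (by rw [a.p_val, c.p_val, h])

lemma fmul_smul (r : ℂ) (a : Fib Ω x) (b : Fib Ω y) :
    fmul h hz a (r • b) = r • fmul h hz a b :=
  Fib.ext <| Ω.bmul_bsmul _ _ _ (by rw [a.p_val, b.p_val, h])

lemma smul_fmul (r : ℂ) (a : Fib Ω x) (b : Fib Ω y) :
    fmul h hz (r • a) b = r • fmul h hz a b :=
  Fib.ext <| Ω.bsmul_bmul _ _ _ (by rw [a.p_val, b.p_val, h])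

lemma continuous_fmul : Continuous fun q : Fib Ω x × Fib Ω y => fmul h hz q.1 q.2 := by
  refine isInducing_val.continuous_iff.mpr ?_
  have hc : Continuous fun q : Fib Ω x × Fib Ω y =>
      (⟨(q.1.val, q.2.val), by rw [q.1.p_val, q.2.p_val, h]⟩ :
        {q : Ω.T × Ω.T // Ω.src (Ω.p q.1) = Ω.rng (Ω.p q.2)}) :=
    .subtype_mk ((continuous_val.comp continuous_fst).prodMk (continuous_val.comp continuous_snd)) _
  exact Ω.cont_bmul.comp hc

/-- `fmul` as a bilinear map. -/
def fmulₗ : Fib Ω x →ₗ[ℂ] Fib Ω y →ₗ[ℂ] Fib Ω z :=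
  LinearMap.mk₂ ℂ (fmul h hz) (add_fmul h hz) (smul_fmul h hz) (fmul_add h hz) (fmul_smul h hz)

@[simp] lemma fmulₗ_apply (a : Fib Ω x) (b : Fib Ω y) : fmulₗ h hz a b = fmul h hz a b := rfl

end

section

variable (h : Ω.ginv x = y)

@[simp] lemma fstar_val (a : Fib Ω x) : (fstar h a).val = Ω.bstar a.val := rfl

lemma fstar_add (a b : Fib Ω x) : fstar h (a + b) = fstar h a + fstar h b :=
  Fib.ext <| Ω.bstar_badd _ _ (a.p_val.trans b.p_val.symm)

lemma fstar_smul (r : ℂ) (a : Fib Ω x) : fstar h (r • a) = star r • fstar h a :=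
  Fib.ext <| Ω.bstar_bsmul _ _

end

end Fib

variable (Ω) in
lemma src_of_unit {u : Ω.G} (h : Ω.rng u = u) : Ω.src u = u := by rw [← h, Ω.src_rng]

variable (Ω) in
lemma gmul_of_unit {u : Ω.G} (h : Ω.rng u = u) : Ω.gmul u u = u := by
  simpa [Ω.src_of_unit h] using Ω.gmul_src u

namespace Fib

section CStar

variable {u : Ω.G} [hu : Fact (Ω.rng u = u)]

instance : Mul (Fib Ω u) :=
  ⟨fmul ((Ω.src_of_unit hu.out).trans hu.out.symm) (Ω.gmul_of_unit hu.out)⟩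

instance : Star (Fib Ω u) := ⟨fstar (Ω.ginv_unit u hu.out)⟩

@[simp] lemma mul_val (a b : Fib Ω u) : (a * b).val = Ω.bmul a.val b.val := rfl
@[simp] lemma star_val (a : Fib Ω u) : (star a).val = Ω.bstar a.val := rfl

lemma src_p_eq (a b : Fib Ω u) : Ω.src (Ω.p a.val) = Ω.rng (Ω.p b.val) := by
  rw [a.p_val, b.p_val, hu.out, Ω.src_of_unit hu.out]

instance : NonUnitalCStarAlgebra (Fib Ω u) where
  __ := (inferInstance : NormedAddCommGroup (Fib Ω u))
  __ := (inferInstance : NormedSpace ℂ (Fib Ω u))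
  __ := (inferInstance : CompleteSpace (Fib Ω u))
  left_distrib := fmul_add _ _
  right_distrib := add_fmul _ _
  zero_mul a := (fmulₗ _ _).map_zero₂ a
  mul_zero a := (fmulₗ _ _ a).map_zero
  mul_assoc a b c := Fib.ext <| Ω.bmul_assoc _ _ _ (src_p_eq a b) (src_p_eq b c)
  star_involutive a := Fib.ext <| Ω.bstar_bstar _
  star_mul a b := Fib.ext <| Ω.bstar_bmul _ _ (src_p_eq a b)
  star_add := fstar_add _
  star_smul := fstar_smul _
  smul_assoc r a b := smul_fmul _ _ r a b
  smul_comm r a b := (fmul_smul _ _ r a b).symm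
  norm_mul_le a b := Ω.unit_submul _ _ (a.p_val.trans b.p_val.symm) (by rw [a.p_val, hu.out])
  norm_mul_self_le a := by
    rw [← sq, norm_def, norm_def, ← Ω.cstar_identity]
    rfl

end CStar

instance (u : Ω.toLCGroupoid.UnitSpace) : Fact (Ω.rng u.1 = u.1) := ⟨u.2⟩
instance : Fact (Ω.rng (Ω.src x) = Ω.src x) := ⟨Ω.rng_src x⟩
instance : Fact (Ω.rng (Ω.rng x) = Ω.rng x) := ⟨Ω.rng_rng x⟩

lemma foldr_val (l : List (Fib Ω x)) :
    (l.map val).foldr Ω.badd (Ω.bzero x) = l.sum.val := by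
  induction l with
  | nil => rfl
  | cons a l ih => simp [ih]

end Fib

open scoped Pointwise in
lemma closedSpan_eq (x : Ω.G) {S : Set Ω.T} (hS : S ⊆ Ω.fiberSet x) :
    Ω.closedSpan x S =
      Fib.val '' closure (Submodule.span ℂ (Fib.val ⁻¹' S : Set (Fib Ω x)) : Set (Fib Ω x)) := by
  rw [← Fib.isClosedEmbedding_val.closure_image_eq, closedSpan]
  congr 1
  rw [← Submodule.coe_toAddSubmonoid, Submodule.span_eq_closure]
  ext t
  constructor
  · rintro ⟨l, hl, rfl⟩
    choose! c s hs hc using hl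
    obtain ⟨m, rfl, hm⟩ : ∃ m : List (Fib Ω x), m.map Fib.val = l ∧
        ∀ a ∈ m, a ∈ (Set.univ : Set ℂ) • (Fib.val ⁻¹' S : Set (Fib Ω x)) := by
      refine ⟨l.attach.map fun a => c a.1 • (⟨s a.1, hS (hs a.1 a.2)⟩ : Fib Ω x), ?_, ?_⟩
      · simp only [List.map_map]
        conv_rhs => rw [← List.attach_map_subtype_val l]
        exact List.map_congr_left fun a _ => (hc a.1 a.2).symm
      · simp only [List.mem_map, forall_exists_index, and_imp]
        rintro _ a - rfl
        exact Set.smul_mem_smul (Set.mem_univ _) (hs a.1 a.2)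
    exact ⟨m.sum, AddSubmonoid.list_sum_mem _ fun a ha => AddSubmonoid.subset_closure (hm a ha),
      (Fib.foldr_val m).symm⟩
  · rintro ⟨w, hw, rfl⟩
    obtain ⟨l, hl, rfl⟩ := AddSubmonoid.exists_list_of_mem_closure hw
    refine ⟨l.map Fib.val, ?_, (Fib.foldr_val l).symm⟩
    simp only [List.mem_map, forall_exists_index, and_imp]
    rintro _ a ha rfl
    obtain ⟨c, -, s, hs, rfl⟩ := Set.mem_smul.mp (hl a ha)
    exact ⟨c, s.val, hs, rfl⟩

end FellBundleData

namespace FellBundleData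

variable {Ω : FellBundleData}

/-! ### Existence of sufficiently many continuous sections -/

namespace Fib

/-- A cofibred version of `ContinuousAt.eventually` for the addition of the bundle. -/
lemma exists_nhds_add_mem {y : Ω.G} (a b : Fib Ω y) {O : Set Ω.T} (hO : O ∈ 𝓝 (a + b).val) :
    ∃ N ∈ 𝓝 a.val, ∃ M ∈ 𝓝 b.val, ∀ (z : Ω.G) (c d : Fib Ω z), c.val ∈ N → d.val ∈ M →
      (c + d).val ∈ O := by
  let q : {q : Ω.T × Ω.T // Ω.p q.1 = Ω.p q.2} := ⟨(a.val, b.val), a.p_val.trans b.p_val.symm⟩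
  have h : ∀ᶠ q in 𝓝 q, Ω.badd q.1.1 q.1.2 ∈ O := Ω.cont_badd.continuousAt.eventually hO
  obtain ⟨S, hS, hSO⟩ := mem_nhds_subtype _ _ _ |>.mp h
  obtain ⟨N, hN, M, hM, hNM⟩ := mem_nhds_prod_iff.mp hS
  exact ⟨N, hN, M, hM, fun z c d hc hd =>
    hSO (a := ⟨(c.val, d.val), c.p_val.trans d.p_val.symm⟩) (hNM ⟨hc, hd⟩)⟩

lemma exists_nhds_smul_mem {y : Ω.G} (r : ℂ) (a : Fib Ω y) {O : Set Ω.T}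
    (hO : O ∈ 𝓝 (r • a).val) :
    ∃ V ∈ 𝓝 r, ∃ N ∈ 𝓝 a.val, ∀ s ∈ V, ∀ (z : Ω.G) (c : Fib Ω z), c.val ∈ N →
      (s • c).val ∈ O := by
  have h : ∀ᶠ q in 𝓝 (r, a.val), Ω.bsmul q.1 q.2 ∈ O := Ω.cont_bsmul.continuousAt.eventually hO
  obtain ⟨V, hV, N, hN, h⟩ := mem_nhds_prod_iff.mp h
  exact ⟨V, hV, N, hN, fun s hs z c hc => h (a := (s, c.val)) ⟨hs, hc⟩⟩

lemma eventually_norm_lt {y : Ω.G} (a : Fib Ω y) {δ : ℝ} (h : ‖a‖ < δ) :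
    ∃ N ∈ 𝓝 a.val, ∀ (z : Ω.G) (c : Fib Ω z), c.val ∈ N → ‖c‖ < δ :=
  ⟨_, Ω.usc_bnorm a.val δ h, fun _ _ hc => hc⟩

/-- Every point has arbitrarily thin neighbourhoods. -/
lemma exists_isOpen_norm_sub_lt {y : Ω.G} (a : Fib Ω y) {δ : ℝ} (hδ : 0 < δ) :
    ∃ N, IsOpen N ∧ a.val ∈ N ∧ ∀ (z : Ω.G) (c d : Fib Ω z), c.val ∈ N → d.val ∈ N →
      ‖c - d‖ < δ := by
  obtain ⟨O, hO, h⟩ := eventually_norm_lt (0 : Fib Ω y) (by simpa using hδ)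
  obtain ⟨N, hN, M, hM, hNM⟩ := exists_nhds_add_mem a ((-1 : ℂ) • a) (O := O) (by
    simpa [← sub_eq_add_neg] using hO)
  obtain ⟨V, hV, N', hN', h'⟩ := exists_nhds_smul_mem _ a hM
  obtain ⟨W, hWN, hW, haW⟩ := mem_nhds_iff.mp (inter_mem hN hN')
  refine ⟨W, hW, haW, fun z c d hc hd => ?_⟩
  have := h z _ (hNM z c _ (hWN hc).1 (h' (-1) (mem_of_mem_nhds hV) z d (hWN hd).2))
  simpa [← sub_eq_add_neg] using this

end Fib

/-- The section `f` is, near `y`, within `ε` of points of the bundle close to `f y`. -/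
def ApproxContAt (f : ∀ x, Fib Ω x) (y : Ω.G) (ε : ℝ) : Prop :=
  ∀ η > ε, ∀ O ∈ 𝓝 (f y).val, ∀ᶠ z in 𝓝 y, ∃ c : Fib Ω z, c.val ∈ O ∧ ‖c - f z‖ < η

namespace ApproxContAt

variable {f g : ∀ x, Fib Ω x} {y : Ω.G} {ε δ : ℝ}

lemma add (hf : ApproxContAt f y ε) (hg : ApproxContAt g y δ) : ApproxContAt (f + g) y (ε + δ) := by
  intro η hη O hO
  obtain ⟨N, hN, M, hM, h⟩ := Fib.exists_nhds_add_mem (f y) (g y) hO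
  filter_upwards [hf (ε + (η - (ε + δ)) / 2) (by linarith) N hN,
    hg (δ + (η - (ε + δ)) / 2) (by linarith) M hM] with z ⟨c, hc, hcf⟩ ⟨d, hd, hdg⟩
  refine ⟨c + d, h z c d hc hd, ?_⟩
  calc ‖c + d - (f + g) z‖ = ‖(c - f z) + (d - g z)‖ := by
        rw [Pi.add_apply]; congr 1; abel
    _ ≤ ‖c - f z‖ + ‖d - g z‖ := norm_add_le _ _
    _ < η := by linarith

lemma smul (hf : ApproxContAt f y ε) {φ : Ω.G → ℂ} (hφ : ContinuousAt φ y) :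
    ApproxContAt (fun z => φ z • f z) y (‖φ y‖ * ε) := by
  intro η hη O hO
  obtain ⟨V, hV, N, hN, h⟩ := Fib.exists_nhds_smul_mem (φ y) (f y) hO
  obtain ⟨η', hη', hlt⟩ : ∃ η' > ε, ‖φ y‖ * η' < η := by
    have hc : ContinuousAt (fun t : ℝ => ‖φ y‖ * t) ε := by fun_prop
    have h1 : ∀ᶠ t in 𝓝[>] ε, ‖φ y‖ * t < η :=
      (hc.eventually (gt_mem_nhds hη)).filter_mono nhdsWithin_le_nhds
    obtain ⟨t, ht, ht'⟩ := (h1.and self_mem_nhdsWithin).exists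
    exact ⟨t, ht', ht⟩
  have hlt' : ∀ᶠ z in 𝓝 y, ‖φ z‖ * η' < η :=
    (hφ.norm.mul continuousAt_const).eventually (gt_mem_nhds hlt)
  filter_upwards [hf η' hη' N hN, hφ.eventually hV, hlt'] with z ⟨c, hc, hcf⟩ hz hz'
  refine ⟨φ z • c, h _ hz z c hc, ?_⟩
  calc ‖φ z • c - φ z • f z‖ = ‖φ z‖ * ‖c - f z‖ := by rw [← smul_sub, norm_smul]
    _ ≤ ‖φ z‖ * η' := by gcongr
    _ < η := hz'

lemma of_eventually_eq_zero (h : ∀ᶠ z in 𝓝 y, f z = 0) : ApproxContAt f y 0 := by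
  intro η hη O hO
  rw [h.self_of_nhds] at hO
  filter_upwards [h, Ω.cont_bzero.continuousAt.eventually hO] with z hz hz'
  exact ⟨0, hz', by simpa [hz] using hη⟩

lemma sum {ι : Type*} (s : Finset ι) {F : ι → ∀ x, Fib Ω x} {e : ι → ℝ}
    (h : ∀ i ∈ s, ApproxContAt (F i) y (e i)) : ApproxContAt (∑ i ∈ s, F i) y (∑ i ∈ s, e i) := by
  classical
  induction s using Finset.induction_on with
  | empty => exact of_eventually_eq_zero (by simp)
  | insert i s hi ih =>
    rw [Finset.sum_insert hi, Finset.sum_insert hi]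
    exact (h i (Finset.mem_insert_self _ _)).add (ih fun j hj => h j (Finset.mem_insert_of_mem hj))

lemma of_norm_sub_le (hf : ApproxContAt f y ε) (h : ∀ᶠ z in 𝓝 y, ‖f z - g z‖ ≤ δ) :
    ApproxContAt g y (ε + 2 * δ) := by
  intro η hη O hO
  set θ := (η - (ε + 2 * δ)) / 2
  have hθ : 0 < θ := by simp only [θ]; linarith
  obtain ⟨N, hN, M, hM, hNM⟩ := Fib.exists_nhds_add_mem (f y) (g y - f y) (O := O) (by simpa using hO)
  obtain ⟨M', hM', hM''⟩ := Fib.eventually_norm_lt (g y - f y) (δ := δ + θ) (by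
    rw [norm_sub_rev]
    linarith [h.self_of_nhds])
  have hp := Ω.p_open.image_mem_nhds (inter_mem hM hM')
  rw [(g y - f y).p_val] at hp
  filter_upwards [h, hf (ε + θ) (by linarith) N hN, hp] with z hz ⟨c, hc, hcf⟩ ⟨m, ⟨hm, hm'⟩, hmz⟩
  let m' : Fib Ω z := ⟨m, hmz⟩
  refine ⟨c + m', hNM z c m' hc hm, ?_⟩
  have := hM'' z m' hm'
  calc ‖c + m' - g z‖ = ‖(c - f z) + m' + (f z - g z)‖ := by congr 1; abel
    _ ≤ ‖c - f z‖ + ‖m'‖ + ‖f z - g z‖ := norm_add₃_le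
    _ < η := by simp only [θ] at *; linarith

lemma continuousAt (hf : ApproxContAt f y 0) : ContinuousAt (fun z => (f z).val) y := by
  intro W hW
  obtain ⟨N, hN, M, hM, hNM⟩ := Fib.exists_nhds_add_mem (f y) 0 (O := W) (by simpa using hW)
  obtain ⟨V, hV, ε, hε, h⟩ := Ω.zero_nbhd y M hM
  change ∀ᶠ z in 𝓝 y, (f z).val ∈ W
  filter_upwards [hf ε hε N hN, hV] with z ⟨c, hc, hcf⟩ hz
  have h1 : (f z - c).val ∈ M := h _ (by rwa [(f z - c).p_val]) (by
    rwa [← Fib.norm_def, norm_sub_rev])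
  simpa using hNM z c _ hc h1

/-- Any section with values in a thin open set is approximately continuous. -/
lemma of_thin {N : Set Ω.T} (hN : IsOpen N)
    (hthin : ∀ (z : Ω.G) (c d : Fib Ω z), c.val ∈ N → d.val ∈ N → ‖c - d‖ < ε)
    (hf : ∀ᶠ z in 𝓝 y, (f z).val ∈ N) : ApproxContAt f y ε := by
  intro η hη O hO
  have hp := Ω.p_open.image_mem_nhds (inter_mem hO (hN.mem_nhds hf.self_of_nhds))
  rw [(f y).p_val] at hp
  filter_upwards [hf, hp] with z hz ⟨m, ⟨hm, hm'⟩, hmz⟩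
  exact ⟨⟨m, hmz⟩, hm, (hthin z ⟨m, hmz⟩ (f z) hm' hz).trans hη⟩

end ApproxContAt

lemma exists_improved_section {K : Set Ω.G} (hK : IsCompact K) {f : ∀ x, Fib Ω x} {ε δ : ℝ}
    (hε : 0 < ε) (hδ : 0 < δ) (hf : ∀ y ∈ K, ApproxContAt f y ε) :
    ∃ g : ∀ x, Fib Ω x, (∀ y ∈ K, ApproxContAt g y δ) ∧ ∀ y ∈ K, ‖f y - g y‖ ≤ 2 * ε := by
  classical
  have hloc : ∀ y ∈ K, ∃ V, IsOpen V ∧ y ∈ V ∧ ∃ h : ∀ x, Fib Ω x,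
      ∀ z ∈ V, ApproxContAt h z δ ∧ ‖f z - h z‖ ≤ 2 * ε := by
    intro y hy
    obtain ⟨N, hN, hyN, hthin⟩ := Fib.exists_isOpen_norm_sub_lt (f y) hδ
    obtain ⟨V, hV, hVo, hyV⟩ := mem_nhds_iff.mp
      (hf y hy (2 * ε) (by linarith) N (hN.mem_nhds hyN))
    choose! h hhN hhf using hV
    refine ⟨V, hVo, hyV, h, fun z hz => ⟨.of_thin hN hthin ?_, ?_⟩⟩
    · filter_upwards [hVo.mem_nhds hz] with w hw using hhN hw
    · rw [norm_sub_rev]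
      exact (hhf hz).le
  choose! V hVo hyV h hh using hloc
  obtain ⟨t, ht⟩ := hK.elim_nhds_subcover' (fun y _ => V y) fun y hy => (hVo y hy).mem_nhds (hyV y hy)
  obtain ⟨φ, hφ, -⟩ := PartitionOfUnity.exists_isSubordinate_of_locallyFinite_t2space hK
    (fun i : t => V i.1.1) (fun i => hVo _ i.1.2) (locallyFinite_of_finite _) (by
      intro y hy
      obtain ⟨i, hi, hyi⟩ := Set.mem_iUnion₂.mp (ht hy)
      exact Set.mem_iUnion.mpr ⟨⟨i, hi⟩, hyi⟩)
  have hsum {y : Ω.G} (hy : y ∈ K) : ∑ i, φ i y = 1 := by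
    rw [← φ.sum_eq_one hy, finsum_eq_sum_of_fintype]
  have hzero {i : t} {y : Ω.G} (hy : y ∉ V i.1.1) : φ i y = 0 :=
    image_eq_zero_of_notMem_tsupport fun h => hy (hφ i h)
  refine ⟨∑ i, fun z => (φ i z : ℂ) • h i.1.1 z, fun y hy => ?_, fun y hy => ?_⟩
  · have : δ = ∑ i, φ i y * δ := by rw [← Finset.sum_mul, hsum hy, one_mul]
    rw [this]
    refine ApproxContAt.sum _ fun i _ => ?_
    by_cases hi : y ∈ V i.1.1
    · have := (hh i.1.1 i.1.2 y hi).1.smul (φ := fun z => (φ i z : ℂ))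
        (Complex.continuous_ofReal.comp (φ i).continuous).continuousAt
      simpa [abs_of_nonneg (φ.nonneg i y)] using this
    · rw [hzero hi, zero_mul]
      refine .of_eventually_eq_zero ?_
      have : y ∉ tsupport (φ i) := fun h => hi (hφ i h)
      filter_upwards [(isClosed_tsupport _).isOpen_compl.mem_nhds this] with z hz
      rw [image_eq_zero_of_notMem_tsupport hz]
      simp
  · have : f y = ∑ i, (φ i y : ℂ) • f y := by
      rw [← Finset.sum_smul, ← Complex.ofReal_sum, hsum hy, Complex.ofReal_one, one_smul]
    rw [this, Finset.sum_apply, ← Finset.sum_sub_distrib]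
    calc _ ≤ ∑ i, ‖(φ i y : ℂ) • f y - (φ i y : ℂ) • h i.1.1 y‖ := norm_sum_le _ _
      _ ≤ ∑ i, φ i y * (2 * ε) := by
        refine Finset.sum_le_sum fun i _ => ?_
        rw [← smul_sub, norm_smul, Complex.norm_real, Real.norm_of_nonneg (φ.nonneg i y)]
        by_cases hi : y ∈ V i.1.1
        · exact mul_le_mul_of_nonneg_left (hh i.1.1 i.1.2 y hi).2 (φ.nonneg i y)
        · simp [hzero hi]
      _ = 2 * ε := by rw [← Finset.sum_mul, hsum hy, one_mul]

/-- A continuous section near a given point with almost prescribed value. -/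
lemma exists_continuousAt_section {x : Ω.G} (b : Fib Ω x) {ε : ℝ} (hε : 0 < ε) :
    ∃ K ∈ 𝓝 x, IsCompact K ∧ ∃ f : ∀ x, Fib Ω x,
      (∀ y ∈ interior K, ContinuousAt (fun z => (f z).val) y) ∧ ‖f x - b‖ < ε := by
  classical
  obtain ⟨N, hN, hbN, hthin⟩ := Fib.exists_isOpen_norm_sub_lt b (δ := ε / 8) (by positivity)
  have hpN : Ω.p '' N ∈ 𝓝 x := by
    have := Ω.p_open.image_mem_nhds (hN.mem_nhds hbN)
    rwa [b.p_val] at this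
  obtain ⟨K, hKx, hKN, hK⟩ := local_compact_nhds hpN
  have hsel : ∀ z ∈ Ω.p '' N, ∃ c : Fib Ω z, c.val ∈ N := fun z ⟨m, hm, hmz⟩ => ⟨⟨m, hmz⟩, hm⟩
  choose! f₀ hf₀ using hsel
  have hf₀' : ∀ y ∈ K, ApproxContAt f₀ y (ε / 8) := fun y hy => .of_thin hN hthin <| by
    filter_upwards [(Ω.p_open _ hN).mem_nhds (hKN hy)] with z hz using hf₀ z hz
  let S (n : ℕ) := {f : ∀ x, Fib Ω x // ∀ y ∈ K, ApproxContAt f y (ε / 8 / 2 ^ n)}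
  have step (n : ℕ) (f : S n) : ∃ g : S (n + 1), ∀ y ∈ K, ‖f.1 y - g.1 y‖ ≤ 2 * (ε / 8 / 2 ^ n) := by
    obtain ⟨g, hg, hg'⟩ := exists_improved_section hK (δ := ε / 8 / 2 ^ (n + 1)) (by positivity)
      (by positivity) f.2
    exact ⟨⟨g, hg⟩, hg'⟩
  choose next hnext using step
  let F (n : ℕ) : S n := Nat.rec ⟨f₀, by simpa using hf₀'⟩ next n
  have hF (n : ℕ) (y : Ω.G) (hy : y ∈ K) :
      dist ((F n).1 y) ((F (n + 1)).1 y) ≤ (ε / 2) / 2 / 2 ^ n := by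
    rw [dist_eq_norm]
    exact (hnext n (F n) y hy).trans_eq (by ring)
  have hlim : ∀ y ∈ K, ∃ L, Tendsto (fun n => (F n).1 y) atTop (𝓝 L) := fun y hy =>
    cauchySeq_tendsto_of_complete (cauchySeq_of_le_geometric_two fun n => hF n y hy)
  choose! f hf using hlim
  have hFf (n : ℕ) (y : Ω.G) (hy : y ∈ K) : ‖(F n).1 y - f y‖ ≤ ε / 2 / 2 ^ n := by
    rw [← dist_eq_norm]
    exact dist_le_of_le_geometric_two_of_tendsto (fun n => hF n y hy) (hf y hy) n
  refine ⟨K, hKx, hK, f, fun y hy => ApproxContAt.continuousAt fun η hη => ?_, ?_⟩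
  · obtain ⟨n, hn⟩ : ∃ n : ℕ, (9 / 8 * ε) * (1 / 2) ^ n < η := by
      have : Tendsto (fun n : ℕ => (9 / 8 * ε) * (1 / 2 : ℝ) ^ n) atTop (𝓝 ((9 / 8 * ε) * 0)) :=
        (tendsto_pow_atTop_nhds_zero_of_lt_one (by norm_num) (by norm_num)).const_mul _
      rw [mul_zero] at this
      exact (this.eventually (gt_mem_nhds hη)).exists
    refine ((F n).2 y (interior_subset hy)).of_norm_sub_le (g := f) (δ := ε / 2 / 2 ^ n) ?_ η ?_
    · filter_upwards [isOpen_interior.mem_nhds hy] with z hz using hFf n z (interior_subset hz)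
    · refine lt_of_eq_of_lt ?_ hn
      rw [one_div, inv_pow]
      ring
  · have hxK := mem_of_mem_nhds hKx
    have h0 := hFf 0 x hxK
    have h1 := hthin x (f₀ x) b (hf₀ x (hKN hxK)) hbN
    have h2 : (F 0).1 x = f₀ x := rfl
    rw [h2, norm_sub_rev] at h0
    calc ‖f x - b‖ ≤ ‖f x - f₀ x‖ + ‖f₀ x - b‖ := norm_sub_le_norm_sub_add_norm_sub _ _ _
      _ < ε := by simp at h0; linarith

/-- Through almost every point of the bundle passes a compactly supported continuous section. -/
lemma exists_section {x : Ω.G} (b : Fib Ω x) {ε : ℝ} (hε : 0 < ε) :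
    ∃ f : ∀ x, Fib Ω x, Continuous (fun z => (f z).val) ∧
      (∃ K, IsCompact K ∧ ∀ z ∉ K, f z = 0) ∧ ‖f x - b‖ < ε := by
  obtain ⟨K, hKx, hK, f, hf, hfb⟩ := exists_continuousAt_section b hε
  obtain ⟨φ, hφ1, -, hφK, -⟩ := exists_continuousMap_one_of_isCompact_subset_isOpen
    (isCompact_singleton (x := x)) (isOpen_interior (s := K))
    (Set.singleton_subset_iff.mpr (mem_interior_iff_mem_nhds.mpr hKx))
  refine ⟨fun z => (φ z : ℂ) • f z, continuous_iff_continuousAt.mpr fun y => ?_,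
    ⟨K, hK, fun z hz => ?_⟩, ?_⟩
  · by_cases hy : y ∈ interior K
    · have hc : ContinuousAt (fun z => ((φ z : ℂ), (f z).val)) y :=
        (Complex.continuous_ofReal.comp φ.continuous).continuousAt.prodMk (hf y hy)
      exact ContinuousAt.comp (f := fun z => ((φ z : ℂ), (f z).val)) Ω.cont_bsmul.continuousAt hc
    · have hy' : y ∉ tsupport φ := fun h => hy (hφK h)
      refine Ω.cont_bzero.continuousAt.congr ?_
      filter_upwards [(isClosed_tsupport _).isOpen_compl.mem_nhds hy'] with z hz
      rw [image_eq_zero_of_notMem_tsupport hz, Complex.ofReal_zero, zero_smul]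
      rfl
  · have hz' : z ∉ tsupport φ := fun h => hz (interior_subset (hφK h))
    simp [image_eq_zero_of_notMem_tsupport hz']
  · simpa [hφ1 rfl] using hfb

end FellBundleData

namespace FellBundleData

variable {Ω : FellBundleData}

/-! ### The `C*`-algebra of sections over the unit space -/

open scoped ENNReal

/-- Sections over the unit space, as a family of elements of the fibres. -/
abbrev UnitSections (Ω : FellBundleData) : Type := ∀ u : Ω.toLCGroupoid.UnitSpace, Fib Ω u.1

/-- `f` is a continuous section over the unit space vanishing at infinity. -/
structure IsC0 (f : UnitSections Ω) : Prop where
  continuous : Continuous fun u => (f u).val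
  vanish : ∀ ε > 0, ∃ K, IsCompact K ∧ ∀ u ∉ K, ‖f u‖ < ε

lemma isA_iff {σ : Ω.toLCGroupoid.UnitSpace → Ω.T} :
    Ω.IsA σ ↔ ∃ f : UnitSections Ω, IsC0 f ∧ (fun u => (f u).val) = σ :=
  ⟨fun ⟨h1, h2, h3⟩ => ⟨fun u => ⟨σ u, h1 u⟩, ⟨h2, h3⟩, rfl⟩,
    fun ⟨f, hf, h⟩ => h ▸ ⟨fun u => (f u).p_val, hf.continuous, hf.vanish⟩⟩

namespace IsC0

variable {f g : UnitSections Ω}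

lemma exists_norm_le (hf : IsC0 f) : ∃ C, 0 ≤ C ∧ ∀ u, ‖f u‖ ≤ C := by
  obtain ⟨K, hK, h⟩ := hf.vanish 1 one_pos
  have husc : UpperSemicontinuous fun u => ‖f u‖ :=
    UpperSemicontinuous.comp Ω.usc_bnorm hf.continuous
  obtain ⟨C, hC⟩ := (husc.upperSemicontinuousOn K).bddAbove_of_isCompact hK
  refine ⟨max C 1, by positivity, fun u => ?_⟩
  by_cases hu : u ∈ K
  · exact (hC ⟨u, hu, rfl⟩).trans (le_max_left _ _)
  · exact (h u hu).le.trans (le_max_right _ _)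

lemma zero : IsC0 (0 : UnitSections Ω) :=
  ⟨Ω.cont_bzero.comp continuous_subtype_val, fun ε hε => ⟨∅, isCompact_empty, fun u _ => by simpa⟩⟩

lemma add (hf : IsC0 f) (hg : IsC0 g) : IsC0 (f + g) := by
  refine ⟨?_, fun ε hε => ?_⟩
  · have : Continuous fun u : Ω.toLCGroupoid.UnitSpace =>
        (⟨((f u).val, (g u).val), (f u).p_val.trans (g u).p_val.symm⟩ :
          {q : Ω.T × Ω.T // Ω.p q.1 = Ω.p q.2}) :=
      .subtype_mk (hf.continuous.prodMk hg.continuous) _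
    exact Ω.cont_badd.comp this
  · obtain ⟨K, hK, h⟩ := hf.vanish (ε / 2) (by positivity)
    obtain ⟨L, hL, h'⟩ := hg.vanish (ε / 2) (by positivity)
    refine ⟨K ∪ L, hK.union hL, fun u hu => ?_⟩
    have h1 := h u fun hu' => hu (.inl hu')
    have h2 := h' u fun hu' => hu (.inr hu')
    exact (norm_add_le _ _).trans_lt (by linarith)

lemma of_norm_le (hf : IsC0 f) (hg : Continuous fun u => (g u).val) {C : ℝ} (hC : 0 ≤ C)
    (h : ∀ u, ‖g u‖ ≤ C * ‖f u‖) : IsC0 g := by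
  refine ⟨hg, fun ε hε => ?_⟩
  obtain ⟨K, hK, hfK⟩ := hf.vanish (ε / (C + 1)) (by positivity)
  refine ⟨K, hK, fun u hu => ?_⟩
  have h1 := (lt_div_iff₀ (by positivity)).mp (hfK u hu)
  have := norm_nonneg (f u)
  linarith [h u]

lemma smul (hf : IsC0 f) (r : ℂ) : IsC0 (r • f) :=
  hf.of_norm_le (Ω.cont_bsmul.comp (continuous_const.prodMk hf.continuous)) (norm_nonneg r)
    fun u => (norm_smul r (f u)).le

lemma mul (hf : IsC0 f) (hg : IsC0 g) : IsC0 (f * g) := by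
  obtain ⟨C, hC, h⟩ := hf.exists_norm_le
  refine hg.of_norm_le ?_ hC fun u => (norm_mul_le _ _).trans (by gcongr; exact h u)
  have : Continuous fun u : Ω.toLCGroupoid.UnitSpace =>
      (⟨((f u).val, (g u).val), Fib.src_p_eq _ _⟩ :
        {q : Ω.T × Ω.T // Ω.src (Ω.p q.1) = Ω.rng (Ω.p q.2)}) :=
    .subtype_mk (hf.continuous.prodMk hg.continuous) _
  exact Ω.cont_bmul.comp this

lemma star (hf : IsC0 f) : IsC0 (star f) :=
  hf.of_norm_le (Ω.cont_bstar.comp hf.continuous) zero_le_one fun u => by simp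

lemma of_approx (h : ∀ ε > 0, ∃ g : UnitSections Ω, IsC0 g ∧ ∀ u, ‖f u - g u‖ < ε) : IsC0 f := by
  refine ⟨continuous_iff_continuousAt.mpr fun u₀ => ?_, fun ε hε => ?_⟩
  · intro W hW
    change ∀ᶠ u in 𝓝 u₀, (f u).val ∈ W
    obtain ⟨N, hN, M, hM, hNM⟩ := Fib.exists_nhds_add_mem (f u₀) 0 (O := W) (by simpa using hW)
    obtain ⟨V, hV, ε, hε, hVM⟩ := Ω.zero_nbhd u₀.1 M hM
    have hN' := Fib.continuous_val.continuousAt.preimage_mem_nhds (interior_mem_nhds.mpr hN)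
    obtain ⟨δ, hδ, hball⟩ := Metric.mem_nhds_iff.mp hN'
    obtain ⟨g, hg, hfg⟩ := h (min ε δ) (lt_min hε hδ)
    have hgN : (g u₀).val ∈ interior N := by
      refine hball (Metric.mem_ball.mpr ?_)
      rw [dist_comm, dist_eq_norm]
      exact (hfg u₀).trans_le (min_le_right _ _)
    filter_upwards [hg.continuous.continuousAt.preimage_mem_nhds (isOpen_interior.mem_nhds hgN),
      continuous_subtype_val.continuousAt.preimage_mem_nhds hV] with u hu huV
    have h1 : (f u - g u).val ∈ M := hVM _ (by rwa [(f u - g u).p_val])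
      ((hfg u).trans_le (min_le_left _ _))
    simpa using hNM u.1 (g u) (f u - g u) (interior_subset hu) h1
  · obtain ⟨g, hg, hfg⟩ := h (ε / 2) (by positivity)
    obtain ⟨K, hK, hgK⟩ := hg.vanish (ε / 2) (by positivity)
    refine ⟨K, hK, fun u hu => ?_⟩
    calc ‖f u‖ = ‖(f u - g u) + g u‖ := by simp
      _ ≤ ‖f u - g u‖ + ‖g u‖ := norm_add_le _ _
      _ < ε := by linarith [hfg u, hgK u hu]

lemma memℓp (hf : IsC0 f) : Memℓp f ∞ := by
  obtain ⟨C, -, h⟩ := hf.exists_norm_le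
  exact memℓp_infty ⟨C, by rintro _ ⟨u, rfl⟩; exact h u⟩

end IsC0

variable (Ω) in
/-- The `C*`-algebra `Γ₀(G⁰; B)`. -/
def sectionAlgebra :
    NonUnitalStarSubalgebra ℂ (lp (fun u : Ω.toLCGroupoid.UnitSpace => Fib Ω u.1) ∞) where
  carrier := {f | IsC0 (f : UnitSections Ω)}
  zero_mem' := .zero
  add_mem' := .add
  mul_mem' := .mul
  smul_mem' r _ hf := .smul hf r
  star_mem' := .star

instance isClosed_sectionAlgebra : IsClosed
    (Ω.sectionAlgebra : Set (lp (fun u : Ω.toLCGroupoid.UnitSpace => Fib Ω u.1) ∞)) := by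
  refine isClosed_of_closure_subset fun f hf => IsC0.of_approx fun ε hε => ?_
  obtain ⟨g, hg, hfg⟩ := Metric.mem_closure_iff.mp hf ε hε
  refine ⟨g, hg, fun u => ?_⟩
  rw [dist_eq_norm] at hfg
  exact (lp.norm_apply_le_norm ENNReal.top_ne_zero (f - g) u).trans_lt hfg

variable (Ω) in
/-- The `C*`-algebra `Γ₀(G⁰; B)`, as a type. -/
def SectionAlgebra : Type := Ω.sectionAlgebra

instance : NonUnitalCStarAlgebra Ω.SectionAlgebra :=
  inferInstanceAs (NonUnitalCStarAlgebra Ω.sectionAlgebra)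

variable (Ω) in
/-- The quotient map from `Γ₀(G⁰; B)` onto the fibre over a unit. -/
def evalHom (u : Ω.G) [hu : Fact (Ω.rng u = u)] : Ω.SectionAlgebra →⋆ₙₐ[ℂ] Fib Ω u where
  toFun f := f.1 ⟨u, hu.out⟩
  map_smul' _ _ := rfl
  map_zero' := rfl
  map_add' _ _ := rfl
  map_mul' _ _ := rfl
  map_star' _ := rfl

/-- The element of `Γ₀(G⁰; B)` given by a section. -/
def IsC0.toSectionAlgebra {f : UnitSections Ω} (hf : IsC0 f) : Ω.SectionAlgebra :=
  ⟨⟨f, hf.memℓp⟩, hf⟩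

variable (Ω) in
lemma isClosed_units : IsClosed {u : Ω.G | Ω.rng u = u} := by
  refine isClosed_eq ?_ continuous_id
  have : Continuous fun x : Ω.G => (⟨(x, Ω.ginv x), (Ω.rng_ginv x).symm⟩ :
      {q : Ω.G × Ω.G // Ω.src q.1 = Ω.rng q.2}) :=
    .subtype_mk (continuous_id.prodMk Ω.cont_ginv) _
  exact (Ω.cont_gmul.comp this).congr Ω.gmul_ginv

lemma surjective_evalHom (u : Ω.G) [hu : Fact (Ω.rng u = u)] :
    Function.Surjective (Ω.evalHom u) := by
  refine fun b => ((isClosed_range_starAlgHom (Ω.evalHom u)).closure_subset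
    (Metric.mem_closure_iff.mpr fun ε hε => ?_) : b ∈ Set.range (Ω.evalHom u))
  obtain ⟨f, hf, ⟨K, hK, hfK⟩, hfb⟩ := exists_section b hε
  have hC0 : IsC0 (Ω := Ω) fun u => f u.1 := by
    refine ⟨hf.comp continuous_subtype_val, fun ε hε => ⟨Subtype.val ⁻¹' K, ?_, fun u hu => ?_⟩⟩
    · exact Ω.isClosed_units.isClosedEmbedding_subtypeVal.isCompact_preimage hK
    · rw [hfK _ hu, norm_zero]
      exact hε
  exact ⟨_, ⟨hC0.toSectionAlgebra, rfl⟩, by rwa [dist_comm, dist_eq_norm]⟩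

variable {I : Set (Ω.toLCGroupoid.UnitSpace → Ω.T)}

/-- An ideal of `Γ₀(G⁰; B)`, as a subspace. -/
def IsIdealA.toSubmodule (hI : Ω.IsIdealA I) : Submodule ℂ Ω.SectionAlgebra where
  carrier := {f | (fun u => (f.1 u).val) ∈ I}
  zero_mem' := hI.2.1
  add_mem' {_ _} hf hg := hI.2.2.1 _ hf _ hg
  smul_mem' r _ hf := hI.2.2.2.1 r _ hf

lemma isA_val (f : Ω.SectionAlgebra) : Ω.IsA fun u => (f.1 u).val := isA_iff.mpr ⟨_, f.2, rfl⟩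

lemma IsIdealA.isClosedIdeal_toSubmodule (hI : Ω.IsIdealA I) : IsClosedIdeal hI.toSubmodule where
  isClosed := by
    refine isClosed_of_closure_subset fun f hf => hI.2.2.2.2.2 _ (isA_val f) fun ε hε => ?_
    obtain ⟨g, hg, hfg⟩ := Metric.mem_closure_iff.mp hf ε hε
    refine ⟨_, hg, fun u => ?_⟩
    rw [dist_eq_norm] at hfg
    rw [← Fib.norm_sub_def]
    exact (lp.norm_apply_le_norm ENNReal.top_ne_zero (f - g).1 u).trans_lt hfg
  mul_mem_left f g hg := (hI.2.2.2.2.1 _ hg _ (isA_val f)).2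
  mul_mem_right f g hg := (hI.2.2.2.2.1 _ hg _ (isA_val f)).1

/-- The fibre `I(u)` of an ideal `I` of `Γ₀(G⁰; B)`, as a subspace of `B(u)`. -/
def IsIdealA.fib (hI : Ω.IsIdealA I) (u : Ω.G) [hu : Fact (Ω.rng u = u)] : Submodule ℂ (Fib Ω u) :=
  hI.toSubmodule.map (Ω.evalHom u : Ω.SectionAlgebra →ₗ[ℂ] Fib Ω u)

lemma IsIdealA.mem_fib (hI : Ω.IsIdealA I) {u : Ω.G} [hu : Fact (Ω.rng u = u)] {a : Fib Ω u} :
    a ∈ hI.fib u ↔ a.val ∈ Ω.fiberIm I u := by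
  constructor
  · rintro ⟨f, hf, rfl⟩
    exact ⟨_, hf, hu.out, rfl⟩
  · rintro ⟨σ, hσ, h, ha⟩
    obtain ⟨f, hf, rfl⟩ := isA_iff.mp (hI.1 σ hσ)
    exact ⟨hf.toSectionAlgebra, hσ, Fib.ext ha.symm⟩

lemma IsIdealA.isClosedIdeal_fib (hI : Ω.IsIdealA I) (u : Ω.G) [hu : Fact (Ω.rng u = u)] :
    IsClosedIdeal (hI.fib u) where
  isClosed := hI.isClosedIdeal_toSubmodule.isClosed_image (Ω.evalHom u)
  mul_mem_left a := by
    rintro _ ⟨f, hf, rfl⟩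
    obtain ⟨g, rfl⟩ := surjective_evalHom u a
    exact ⟨g * f, hI.isClosedIdeal_toSubmodule.mul_mem_left g f hf, rfl⟩
  mul_mem_right a := by
    rintro _ ⟨f, hf, rfl⟩
    obtain ⟨g, rfl⟩ := surjective_evalHom u a
    exact ⟨f * g, hI.isClosedIdeal_toSubmodule.mul_mem_right g f hf, rfl⟩

end FellBundleData

lemma IsClosedIdeal.mem_closure_mul_right {A : Type*} [NonUnitalCStarAlgebra A] {J : Submodule ℂ A}
    (hJ : IsClosedIdeal J) {d : A} (hd : d ∈ J) : d ∈ closure ((d * ·) '' (J : Set A)) :=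
  Metric.mem_closure_iff.mpr fun ε hε => by
    obtain ⟨e, he, -, -, h⟩ := hJ.exists_mem_norm_sub_mul_lt hd hε
    exact ⟨_, ⟨e, he, rfl⟩, by rwa [dist_eq_norm]⟩

lemma IsClosedIdeal.mem_closure_mul_left {A : Type*} [NonUnitalCStarAlgebra A] {J : Submodule ℂ A}
    (hJ : IsClosedIdeal J) {d : A} (hd : d ∈ J) : d ∈ closure ((· * d) '' (J : Set A)) :=
  Metric.mem_closure_iff.mpr fun ε hε => by
    obtain ⟨e, he, -, h⟩ := hJ.exists_mem_norm_sub_mul_lt' hd hε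
    exact ⟨_, ⟨e, he, rfl⟩, by rwa [dist_eq_norm]⟩

/-- If a closed subspace `M` contains `e * a * e'` for all `a` in a total subset of the algebra and
all `e, e'` in the closed ideal `J`, then `M` contains `J`. -/
lemma IsClosedIdeal.le_of_mul_mul_mem {A : Type*} [NonUnitalCStarAlgebra A] {J M : Submodule ℂ A}
    (hJ : IsClosedIdeal J) (hM : IsClosed (M : Set A)) {S : Set A}
    (hS : closure (Submodule.span ℂ S : Set A) = Set.univ)
    (h : ∀ e ∈ J, ∀ a ∈ S, ∀ e' ∈ J, e * a * e' ∈ M) : J ≤ M := by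
  intro d hd
  have h1 : ∀ e ∈ J, ∀ e' ∈ J, e * d * e' ∈ M := by
    intro e he e' he'
    have hd' : d ∈ closure (Submodule.span ℂ S : Set A) := hS ▸ Set.mem_univ d
    refine hM.closure_subset
      (map_mem_closure (f := fun w => e * w * e') (by fun_prop) hd' fun w hw => ?_)
    induction hw using Submodule.span_induction with
    | mem a ha => exact h e he a ha e' he'
    | zero => simp
    | add a b _ _ ha hb => simpa [mul_add, add_mul] using M.add_mem ha hb
    | smul r a _ ha => simpa [mul_smul_comm, smul_mul_assoc] using M.smul_mem r ha
  have h2 : ∀ e' ∈ J, d * e' ∈ M := fun e' he' =>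
    hM.closure_subset (map_mem_closure (f := fun w => w * e') (by fun_prop)
      (hJ.mem_closure_mul_left hd) (by rintro _ ⟨e, he, rfl⟩; exact h1 e he e' he'))
  exact hM.closure_subset (map_mem_closure (f := id) continuous_id
      (hJ.mem_closure_mul_right hd) (by rintro _ ⟨e, he, rfl⟩; exact h2 e he))

namespace FellBundleData

variable {Ω : FellBundleData}

namespace Fib

variable {x : Ω.G}

/-- The right action of `B(s(x))` on `B(x)`. -/
def rmul (a : Fib Ω x) (d : Fib Ω (Ω.src x)) : Fib Ω x :=
  fmul (Ω.rng_src x).symm (Ω.gmul_src x) a d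

/-- The left action of `B(r(x))` on `B(x)`. -/
def lmul (d : Fib Ω (Ω.rng x)) (a : Fib Ω x) : Fib Ω x :=
  fmul (Ω.src_rng x) (Ω.gmul_rng x) d a

/-- The inner product `a* b` on `B(x)`, with values in `B(s(x))`. -/
def rinner (a b : Fib Ω x) : Fib Ω (Ω.src x) :=
  fmul (Ω.src_ginv x) (Ω.ginv_gmul x) (fstar rfl a) b

/-- The inner product `a b*` on `B(x)`, with values in `B(r(x))`. -/
def linner (a b : Fib Ω x) : Fib Ω (Ω.rng x) :=
  fmul (Ω.rng_ginv x).symm (Ω.gmul_ginv x) a (fstar rfl b)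

@[simp] lemma rmul_val (a : Fib Ω x) (d : Fib Ω (Ω.src x)) :
    (rmul a d).val = Ω.bmul a.val d.val := rfl
@[simp] lemma lmul_val (d : Fib Ω (Ω.rng x)) (a : Fib Ω x) :
    (lmul d a).val = Ω.bmul d.val a.val := rfl
@[simp] lemma rinner_val (a b : Fib Ω x) : (rinner a b).val = Ω.bmul (Ω.bstar a.val) b.val := rfl
@[simp] lemma linner_val (a b : Fib Ω x) : (linner a b).val = Ω.bmul a.val (Ω.bstar b.val) := rfl

attribute [simp] p_val

@[fun_prop]
lemma continuous_rmul (a : Fib Ω x) : Continuous (rmul a) :=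
  (continuous_fmul _ _).comp (.prodMk_right a)
@[fun_prop]
lemma continuous_lmul_left (a : Fib Ω x) : Continuous (lmul · a) :=
  (continuous_fmul _ _).comp (.prodMk_left a)
@[fun_prop]
lemma continuous_rinner (a : Fib Ω x) : Continuous (rinner a) :=
  (continuous_fmul _ _).comp (.prodMk_right (fstar rfl a))
@[fun_prop]
lemma continuous_linner_left (b : Fib Ω x) : Continuous (linner · b) :=
  (continuous_fmul _ _).comp (.prodMk_left (fstar rfl b))

lemma bmul_assoc' {a b c : Ω.T} {x y z : Ω.G} (ha : Ω.p a = x) (hb : Ω.p b = y) (hc : Ω.p c = z)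
    (hxy : Ω.src x = Ω.rng y) (hyz : Ω.src y = Ω.rng z) :
    Ω.bmul (Ω.bmul a b) c = Ω.bmul a (Ω.bmul b c) :=
  Ω.bmul_assoc _ _ _ (by rw [ha, hb, hxy]) (by rw [hb, hc, hyz])

lemma p_bstar_val (a : Fib Ω x) : Ω.p (Ω.bstar a.val) = Ω.ginv x := (fstar rfl a).p_val

/-- `rinner a` as a linear map. -/
def rinnerₗ (a : Fib Ω x) : Fib Ω x →ₗ[ℂ] Fib Ω (Ω.src x) :=
  fmulₗ (Ω.src_ginv x) (Ω.ginv_gmul x) (fstar rfl a)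

/-- The left action on a fixed element of `B(x)`, as a linear map. -/
def lmulₗ (a : Fib Ω x) : Fib Ω (Ω.rng x) →ₗ[ℂ] Fib Ω x :=
  (fmulₗ (Ω.src_rng x) (Ω.gmul_rng x)).flip a

lemma rinner_rmul (a b : Fib Ω x) (d : Fib Ω (Ω.src x)) :
    rinner a (rmul b d) = rinner a b * d :=
  Fib.ext (bmul_assoc' a.p_bstar_val b.p_val d.p_val (Ω.src_ginv x) (Ω.rng_src x).symm).symm

lemma linner_lmul_left (a b : Fib Ω x) (d : Fib Ω (Ω.rng x)) :
    linner (lmul d a) b = d * linner a b :=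
  Fib.ext (bmul_assoc' d.p_val a.p_val b.p_bstar_val (Ω.src_rng x) (Ω.rng_ginv x).symm)

lemma star_rinner (a b : Fib Ω x) : star (rinner a b) = rinner b a :=
  Fib.ext <| by simp [Ω.bstar_bmul, Ω.bstar_bstar, Ω.p_bstar, Ω.src_ginv]

lemma star_linner (a b : Fib Ω x) : star (linner a b) = linner b a :=
  Fib.ext <| by simp [Ω.bstar_bmul, Ω.bstar_bstar, Ω.p_bstar, Ω.rng_ginv]

lemma rinner_rmul_left (a b : Fib Ω x) (d : Fib Ω (Ω.src x)) :
    rinner (rmul a d) b = star d * rinner a b := by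
  rw [← star_rinner, rinner_rmul, star_mul, star_rinner]

lemma linner_lmul (a b : Fib Ω x) (d : Fib Ω (Ω.rng x)) :
    linner a (lmul d b) = linner a b * star d := by
  rw [← star_linner, linner_lmul_left, star_mul, star_linner]

lemma lmul_linner (a b c : Fib Ω x) : lmul (linner a b) c = rmul a (rinner b c) :=
  Fib.ext (bmul_assoc' a.p_val b.p_bstar_val c.p_val (Ω.rng_ginv x).symm (Ω.src_ginv x))

lemma lmul_lmul (a : Fib Ω x) (d d' : Fib Ω (Ω.rng x)) : lmul d (lmul d' a) = lmul (d * d') a :=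
  Fib.ext (bmul_assoc' d.p_val d'.p_val a.p_val (by rw [Ω.src_rng, Ω.rng_rng]) (Ω.src_rng x)).symm

lemma rinner_lmul_left (a b : Fib Ω x) (d : Fib Ω (Ω.rng x)) :
    rinner (lmul d a) b = rinner a (lmul (star d) b) := by
  refine Fib.ext ?_
  simp only [rinner_val, lmul_val, star_val]
  rw [Ω.bstar_bmul _ _ (by simp [Ω.src_rng])]
  exact bmul_assoc' a.p_bstar_val (star d).p_val b.p_val (by rw [Ω.src_ginv, Ω.rng_rng])
    (Ω.src_rng x)

lemma norm_rinner_self (a : Fib Ω x) : ‖rinner a a‖ = ‖a‖ ^ 2 := Ω.cstar_identity _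

lemma rmul_sub_norm_sq (b : Fib Ω x) {e : Fib Ω (Ω.src x)} (he : IsSelfAdjoint e) :
    ‖b - rmul b e‖ ^ 2 =
      ‖rinner b b - rinner b b * e - e * rinner b b + e * rinner b b * e‖ := by
  have h1 : ∀ a c d : Fib Ω x, rinner a (c - d) = rinner a c - rinner a d :=
    fun a c d => map_sub (rinnerₗ a) c d
  have h2 : ∀ a c d : Fib Ω x, rinner (c - d) a = rinner c a - rinner d a := fun a c d => by
    rw [← star_rinner, h1, star_sub, star_rinner, star_rinner]
  rw [← norm_rinner_self, h1, h2, h2, rinner_rmul, rinner_rmul, rinner_rmul_left, he.star_eq]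
  congr 1
  abel

/-- If `b* b` lies in the closed ideal `J` of `B(s(x))`, then `b` is a limit of elements `b e` with
`e ∈ J`. -/
lemma mem_closure_rmul {J : Submodule ℂ (Fib Ω (Ω.src x))} (hJ : IsClosedIdeal J) {b : Fib Ω x}
    (hb : rinner b b ∈ J) : b ∈ closure (rmul b '' (J : Set (Fib Ω (Ω.src x)))) := by
  refine Metric.mem_closure_iff.mpr fun ε hε => ?_
  obtain ⟨c, hc, hcb⟩ := Ω.bmul_pos b.val
  rw [b.p_val] at hc
  have hcb' : rinner b b = star (⟨c, hc⟩ : Fib Ω (Ω.src x)) * ⟨c, hc⟩ := Fib.ext hcb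
  obtain ⟨e, he, -, ⟨r, her⟩, hlt⟩ :=
    exists_approx_unit_star_mul_self (⟨c, hc⟩ : Fib Ω (Ω.src x)) (pow_pos hε 2)
  rw [← hcb'] at her hlt
  refine ⟨_, ⟨e, hJ.mem_of_eq_smul_sub hb her, rfl⟩, ?_⟩
  rw [dist_eq_norm]
  rw [← rmul_sub_norm_sq b he] at hlt
  exact lt_of_pow_lt_pow_left₀ 2 hε.le hlt

lemma rinner_mem {J : Submodule ℂ (Fib Ω (Ω.src x))} (hJ : IsClosedIdeal J) {b : Fib Ω x}
    (hb : rinner b b ∈ J) (c : Fib Ω x) : rinner c b ∈ J :=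
  hJ.isClosed.closure_subset (map_mem_closure (continuous_rinner c) (mem_closure_rmul hJ hb) <| by
    rintro _ ⟨e, he, rfl⟩
    rw [rinner_rmul]
    exact hJ.mul_mem_left _ e he)

lemma rinner_rmul_self_mem {J : Submodule ℂ (Fib Ω (Ω.src x))} (hJ : IsClosedIdeal J)
    (b : Fib Ω x) {d : Fib Ω (Ω.src x)} (hd : d ∈ J) : rinner (rmul b d) (rmul b d) ∈ J := by
  rw [rinner_rmul]
  exact hJ.mul_mem_left _ d hd

lemma setOf_rinner_self_mem {J : Submodule ℂ (Fib Ω (Ω.src x))} (hJ : IsClosedIdeal J) :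
    {b : Fib Ω x | rinner b b ∈ J} =
      closure (Submodule.span ℂ {b : Fib Ω x | ∃ c, ∃ d ∈ J, b = rmul c d}) := by
  refine Set.Subset.antisymm (fun b hb => ?_) fun b hb => ?_
  · refine closure_mono ?_ (mem_closure_rmul hJ hb)
    rintro _ ⟨e, he, rfl⟩
    exact Submodule.subset_span ⟨b, e, he, rfl⟩
  · have hle : Submodule.span ℂ {b : Fib Ω x | ∃ c, ∃ d ∈ J, b = rmul c d} ≤
        J.comap (rinnerₗ b) := by
      refine Submodule.span_le.mpr ?_
      rintro _ ⟨c, d, hd, rfl⟩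
      change rinner b (rmul c d) ∈ J
      rw [rinner_rmul]
      exact hJ.mul_mem_left _ d hd
    exact hJ.isClosed.closure_subset (map_mem_closure (continuous_rinner b) hb hle)

end Fib

open Fib

variable {I : Set (Ω.toLCGroupoid.UnitSpace → Ω.T)}

lemma mem_BIset (hI : Ω.IsIdealA I) {x : Ω.G} (b : Fib Ω x) :
    b.val ∈ Ω.BIset I ↔ rinner b b ∈ hI.fib (Ω.src x) := by
  rw [hI.mem_fib, BIset, Set.mem_ofPred_eq, b.p_val]
  rfl

lemma BIset_fiber (hI : Ω.IsIdealA I) (x : Ω.G) :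
    {b | b ∈ Ω.BIset I ∧ Ω.p b = x} =
      Ω.closedSpan x {t | ∃ c d, Ω.p c = x ∧ d ∈ Ω.fiberIm I (Ω.src x) ∧ t = Ω.bmul c d} := by
  have hp : ∀ d ∈ Ω.fiberIm I (Ω.src x), Ω.p d = Ω.src x := by
    rintro _ ⟨σ, hσ, h, rfl⟩
    exact (hI.1 σ hσ).1 _
  have hpre : (Fib.val ⁻¹' {t | ∃ c d, Ω.p c = x ∧ d ∈ Ω.fiberIm I (Ω.src x) ∧ t = Ω.bmul c d} :
      Set (Fib Ω x)) = {b | ∃ c, ∃ d ∈ hI.fib (Ω.src x), b = rmul c d} := by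
    ext b
    constructor
    · rintro ⟨c, d, hc, hd, h⟩
      exact ⟨⟨c, hc⟩, ⟨d, hp d hd⟩, hI.mem_fib.mpr hd, Fib.ext h⟩
    · rintro ⟨c, d, hd, rfl⟩
      exact ⟨c.val, d.val, c.p_val, hI.mem_fib.mp hd, rfl⟩
  rw [closedSpan_eq x, hpre, ← setOf_rinner_self_mem (hI.isClosedIdeal_fib _)]
  · ext b
    constructor
    · rintro ⟨hb, rfl⟩
      exact ⟨⟨b, rfl⟩, (mem_BIset hI ⟨b, rfl⟩).mp hb, rfl⟩
    · rintro ⟨b, hb, rfl⟩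
      exact ⟨(mem_BIset hI b).mpr hb, b.p_val⟩
  · rintro _ ⟨c, d, hc, hd, rfl⟩
    exact (rmul ⟨c, hc⟩ ⟨d, hp d hd⟩).p_val

lemma isOpenMap_BIset (hI : Ω.IsIdealA I) :
    IsOpenMap fun b : {b : Ω.T // b ∈ Ω.BIset I} => Ω.p b.1 := by
  refine isOpenMap_iff_nhds_le.mpr fun ⟨b, hb⟩ s hs => ?_
  obtain ⟨O, hO, hOs⟩ := mem_nhds_subtype _ _ _ |>.mp (mem_map.mp hs)
  have hb' := mem_closure_rmul (hI.isClosedIdeal_fib _) ((mem_BIset hI ⟨b, rfl⟩).mp hb)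
  obtain ⟨_, heO, ⟨e, he, rfl⟩⟩ := mem_closure_iff_nhds.mp hb' _
    (continuous_val.continuousAt.preimage_mem_nhds (interior_mem_nhds.mpr hO))
  obtain ⟨σ, hσ, h, hσe⟩ := hI.mem_fib.mp he
  have hc : Continuous fun c => Ω.src (Ω.p c) := by
    have : Continuous fun x : Ω.G => (⟨(Ω.ginv x, x), Ω.src_ginv x⟩ :
        {q : Ω.G × Ω.G // Ω.src q.1 = Ω.rng q.2}) :=
      .subtype_mk (Ω.cont_ginv.prodMk continuous_id) _
    exact ((Ω.cont_gmul.comp this).congr Ω.ginv_gmul).comp Ω.p_cont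
  have hσp := (hI.1 σ hσ).1
  let τ : ∀ c, Fib Ω (Ω.src (Ω.p c)) := fun c => ⟨σ ⟨Ω.src (Ω.p c), Ω.rng_src _⟩, hσp _⟩
  let m : ∀ c, Fib Ω (Ω.p c) := fun c => rmul ⟨c, rfl⟩ (τ c)
  have hm : Continuous fun c => (m c).val := by
    have : Continuous fun c : Ω.T => (⟨(c, (τ c).val), by rw [(τ c).p_val, Ω.rng_src]⟩ :
        {q : Ω.T × Ω.T // Ω.src (Ω.p q.1) = Ω.rng (Ω.p q.2)}) :=
      .subtype_mk (continuous_id.prodMk ((hI.1 σ hσ).2.1.comp (hc.subtype_mk _))) _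
    exact Ω.cont_bmul.comp this
  have hmb : (m b).val ∈ interior O := by
    have : τ b = e := Fib.ext hσe.symm
    simp only [m, this]
    exact heO
  refine mem_of_superset (Ω.p_open.image_mem_nhds
    (hm.continuousAt.preimage_mem_nhds (isOpen_interior.mem_nhds hmb))) ?_
  rintro _ ⟨c, hcO, rfl⟩
  have hcI : (m c).val ∈ Ω.BIset I := (mem_BIset hI _).mpr <|
    rinner_rmul_self_mem (hI.isClosedIdeal_fib _) _ (hI.mem_fib.mpr ⟨σ, hσ, _, rfl⟩)
  have := hOs (show (⟨(m c).val, hcI⟩ : {b : Ω.T // b ∈ Ω.BIset I}) ∈ Subtype.val ⁻¹' O from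
    interior_subset (s := O) hcO)
  rwa [Set.mem_preimage, (m c).p_val] at this


lemma mem_fiberIm (hI : Ω.IsIdealA I) {u : Ω.G} {t : Ω.T} (ht : t ∈ Ω.fiberIm I u) :
    Ω.p t = u := by
  obtain ⟨σ, hσ, h, rfl⟩ := ht
  exact (hI.1 σ hσ).1 _

open Classical in
/-- If `I` is invariant then `B(x)* I(r(x)) B(x) ⊆ I(s(x))`. -/
lemma GInvariant.rinner_lmul_mem (hG : Ω.GInvariant I) {x : Ω.G} {d : Fib Ω (Ω.rng x)}
    (hd : d ∈ hG.1.fib (Ω.rng x)) (a b : Fib Ω x) :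
    rinner a (lmul d b) ∈ hG.1.fib (Ω.src x) := by
  by_contra hc
  obtain ⟨H, _, _, _, π, hπI, hπc, hπ⟩ :=
    exists_irreducible_rep (hG.1.isClosedIdeal_fib (Ω.src x)) hc
  let ρ : Ω.T → H →L[ℂ] H := fun t => if h : Ω.p t = Ω.src x then π ⟨t, h⟩ else 0
  have hρ : ∀ t : Fib Ω (Ω.src x), ρ t.val = π t := fun t => dif_pos t.p_val
  have hirr : Ω.IsIrredFiberRep (Ω.src x) ρ := by
    refine ⟨⟨?_, ?_, ?_, ?_, ?_⟩, ⟨_, p_val _, by rwa [hρ]⟩, fun K hK h => hπ K hK fun t v hv => ?_⟩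
    · intro a b ha hb
      have h := map_add π ⟨a, ha⟩ ⟨b, hb⟩
      simp only [← hρ] at h
      exact h
    · intro r a ha
      have h := map_smul π r ⟨a, ha⟩
      simp only [← hρ] at h
      exact h
    · intro a b ha hb
      have h := map_mul π ⟨a, ha⟩ ⟨b, hb⟩
      simp only [← hρ] at h
      exact h
    · intro a ha
      have h := map_star π (⟨a, ha⟩ : Fib Ω (Ω.src x))
      simp only [← hρ] at h
      exact h
    · intro a ha
      have h := NonUnitalStarAlgHom.norm_apply_le π (⟨a, ha⟩ : Fib Ω (Ω.src x))
      simp only [← hρ] at h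
      exact h
    · rw [← hρ]
      exact h _ t.p_val v hv
  have hsub := hG.2 x {t | Ω.p t = Ω.src x ∧ ρ t = 0}
    ⟨Ω.rng_src x, H, _, _, _, ρ, hirr, rfl⟩ fun t ht => by
      have htp := mem_fiberIm hG.1 ht
      exact ⟨htp, (hρ ⟨t, htp⟩).trans (hπI _ (hG.1.mem_fib.mpr ht))⟩
  have hd' := hsub (hG.1.mem_fib.mp hd)
  rw [hIdeal, closedSpan_eq] at hd'
  · obtain ⟨d', hd', hdd⟩ := hd'
    obtain rfl := val_injective hdd
    refine hπc ?_
    have hcont : Continuous fun w => π (rinner a (lmul w b)) :=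
      (continuous_starAlgHom π).comp (by fun_prop)
    have hle : Submodule.span ℂ (Fib.val ⁻¹' {t | ∃ a b d, Ω.p a = x ∧ Ω.p b = x ∧
        d ∈ {t | Ω.p t = Ω.src x ∧ ρ t = 0} ∧ t = Ω.bmul (Ω.bmul a d) (Ω.bstar b)}) ≤
        LinearMap.ker ((π : Fib Ω (Ω.src x) →ₗ[ℂ] (H →L[ℂ] H)) ∘ₗ rinnerₗ a ∘ₗ lmulₗ b) := by
      refine Submodule.span_le.mpr ?_
      rintro w ⟨a', b', d, ha', hb', ⟨hdp, hdρ⟩, hw⟩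
      obtain rfl : w = linner (rmul ⟨a', ha'⟩ ⟨d, hdp⟩) ⟨b', hb'⟩ := Fib.ext hw
      change π (rinner a (lmul _ b)) = 0
      rw [lmul_linner, rinner_rmul, rinner_rmul, map_mul, map_mul,
        show π ⟨d, hdp⟩ = 0 from (hρ ⟨d, hdp⟩).symm.trans hdρ, mul_zero, zero_mul]
    exact (isClosed_singleton.preimage hcont).closure_subset_iff.mpr hle hd'
  · rintro _ ⟨a, b, d, ha, hb, ⟨hd, -⟩, rfl⟩
    exact (linner (rmul ⟨a, ha⟩ ⟨d, hd⟩) ⟨b, hb⟩).p_val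

/-- If `I` is invariant then `B(x) I(s(x)) B(x)* ⊆ I(r(x))`. -/
lemma GInvariant.linner_rmul_mem (hG : Ω.GInvariant I) {x : Ω.G} {d : Fib Ω (Ω.src x)}
    (hd : d ∈ hG.1.fib (Ω.src x)) (a b : Fib Ω x) :
    linner (rmul a d) b ∈ hG.1.fib (Ω.rng x) := by
  have hd' : (⟨d.val, d.p_val.trans (Ω.rng_ginv x).symm⟩ : Fib Ω (Ω.rng (Ω.ginv x))) ∈
      hG.1.fib (Ω.rng (Ω.ginv x)) := by
    refine hG.1.mem_fib.mpr (?_ : d.val ∈ _)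
    rw [Ω.rng_ginv]
    exact hG.1.mem_fib.mp hd
  have h := hG.rinner_lmul_mem hd' (fstar rfl a) (fstar rfl b)
  rw [hG.1.mem_fib] at h
  simp only [rinner_val, lmul_val, fstar_val, Ω.bstar_bstar] at h
  rw [Ω.src_ginv] at h
  rw [hG.1.mem_fib]
  convert h using 1
  exact bmul_assoc' a.p_val d.p_val b.p_bstar_val (Ω.rng_src x).symm
    (by rw [Ω.src_src, Ω.rng_ginv])

lemma GInvariant.linner_mem (hG : Ω.GInvariant I) {x : Ω.G} {a : Fib Ω x}
    (ha : rinner a a ∈ hG.1.fib (Ω.src x)) (b : Fib Ω x) :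
    linner a b ∈ hG.1.fib (Ω.rng x) :=
  (hG.1.isClosedIdeal_fib _).isClosed.closure_subset <|
    map_mem_closure (f := (linner · b)) (continuous_linner_left b)
      (mem_closure_rmul (hG.1.isClosedIdeal_fib _) ha) <| by
        rintro _ ⟨e, he, rfl⟩
        exact hG.linner_rmul_mem he a b

lemma GInvariant.bmul_mem_BIset (hG : Ω.GInvariant I) {a b : Ω.T} (ha : a ∈ Ω.BIset I)
    (hab : Ω.src (Ω.p a) = Ω.rng (Ω.p b)) : Ω.bmul a b ∈ Ω.BIset I := by
  have ha' : (⟨Ω.bmul (Ω.bstar a) a, (rinner ⟨a, rfl⟩ ⟨a, rfl⟩).p_val.trans hab⟩ :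
      Fib Ω (Ω.rng (Ω.p b))) ∈ hG.1.fib (Ω.rng (Ω.p b)) := by
    refine hG.1.mem_fib.mpr (?_ : Ω.bmul (Ω.bstar a) a ∈ _)
    rw [← hab]
    exact ha
  have h := hG.rinner_lmul_mem ha' ⟨b, rfl⟩ ⟨b, rfl⟩
  rw [hG.1.mem_fib] at h
  rw [BIset, Set.mem_ofPred_eq, Ω.p_bmul _ _ hab, Ω.src_gmul _ _ hab]
  convert h using 1
  simp only [rinner_val, lmul_val]
  rw [Ω.bstar_bmul _ _ hab,
    bmul_assoc' (Ω.p_bstar b) (Ω.p_bstar a) (Ω.p_bmul _ _ hab)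
      (by rw [Ω.src_ginv, Ω.rng_ginv, hab]) (by rw [Ω.src_ginv, Ω.rng_gmul _ _ hab]),
    bmul_assoc' (Ω.p_bstar a) rfl rfl (Ω.src_ginv _) hab]

lemma GInvariant.bstar_mem_BIset (hG : Ω.GInvariant I) {a : Ω.T} (ha : a ∈ Ω.BIset I) :
    Ω.bstar a ∈ Ω.BIset I := by
  have h := hG.1.mem_fib.mp (hG.linner_mem ((mem_BIset hG.1 ⟨a, rfl⟩).mp ha) ⟨a, rfl⟩)
  rwa [BIset, Set.mem_ofPred_eq, Ω.p_bstar, Ω.src_ginv, Ω.bstar_bstar]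

lemma BIset_unit_fiber (hI : Ω.IsIdealA I) {u : Ω.G} (hu : Ω.rng u = u) :
    {b | b ∈ Ω.BIset I ∧ Ω.p b = u} = Ω.fiberIm I u := by
  have : Fact (Ω.rng u = u) := ⟨hu⟩
  have key : ∀ b : Fib Ω u, b.val ∈ Ω.BIset I ↔ b.val ∈ Ω.fiberIm I u := fun b => by
    rw [BIset, Set.mem_ofPred_eq, b.p_val, Ω.src_of_unit hu, ← hI.mem_fib, ← star_val, ← mul_val,
      ← hI.mem_fib]
    exact ⟨(hI.isClosedIdeal_fib u).mem_of_star_mul_self_mem,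
      (hI.isClosedIdeal_fib u).mul_mem_left _ _⟩
  ext b
  exact ⟨fun ⟨hb, hp⟩ => (key ⟨b, hp⟩).mp hb, fun hb =>
    ⟨(key ⟨b, mem_fiberIm hI hb⟩).mpr hb, mem_fiberIm hI hb⟩⟩

end FellBundleData

namespace FellBundle

open FellBundleData Fib

variable (Ω : FellBundle) {I : Set (Ω.toLCGroupoid.UnitSpace → Ω.T)}

lemma closure_span_linner (x : Ω.G) :
    closure (Submodule.span ℂ {w : Fib Ω.toFellBundleData (Ω.rng x) | ∃ a b, w = linner a b} :
      Set (Fib Ω.toFellBundleData (Ω.rng x))) = Set.univ := by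
  have h := Ω.saturated x (Ω.ginv x) (Ω.rng_ginv x).symm
  rw [Ω.gmul_ginv, closedSpan_eq, ← range_val, ← Set.image_univ,
    val_injective.image_injective.eq_iff] at h
  · rw [← h]
    congr! 4
    ext w
    constructor
    · rintro ⟨a, b, rfl⟩
      exact ⟨a.val, Ω.bstar b.val, a.p_val, b.p_bstar_val, rfl⟩
    · rintro ⟨a, b, ha, hb, hw⟩
      refine ⟨⟨a, ha⟩, ⟨Ω.bstar b, by rw [Ω.p_bstar, hb, Ω.ginv_ginv]⟩, Fib.ext ?_⟩
      simpa [Ω.bstar_bstar] using hw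
  · rintro _ ⟨a, b, ha, hb, rfl⟩
    exact (fmul (Ω.rng_ginv x).symm (Ω.gmul_ginv x) ⟨a, ha⟩ ⟨b, hb⟩).p_val

lemma closure_span_rinner (x : Ω.G) :
    closure (Submodule.span ℂ {w : Fib Ω.toFellBundleData (Ω.src x) | ∃ a b, w = rinner a b} :
      Set (Fib Ω.toFellBundleData (Ω.src x))) = Set.univ := by
  have h := Ω.saturated (Ω.ginv x) x (Ω.src_ginv x)
  rw [Ω.ginv_gmul, closedSpan_eq, ← range_val, ← Set.image_univ,
    val_injective.image_injective.eq_iff] at h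
  · rw [← h]
    congr! 4
    ext w
    constructor
    · rintro ⟨a, b, rfl⟩
      exact ⟨Ω.bstar a.val, b.val, a.p_bstar_val, b.p_val, rfl⟩
    · rintro ⟨a, b, ha, hb, hw⟩
      refine ⟨⟨Ω.bstar a, by rw [Ω.p_bstar, ha, Ω.ginv_ginv]⟩, ⟨b, hb⟩, Fib.ext ?_⟩
      simpa [Ω.bstar_bstar] using hw
  · rintro _ ⟨a, b, ha, hb, rfl⟩
    exact (fmul (Ω.src_ginv x) (Ω.ginv_gmul x) ⟨a, ha⟩ ⟨b, hb⟩).p_val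

lemma closedSpan_eq_fiberIm (hI : Ω.IsIdealA I) {u : Ω.G} [Fact (Ω.rng u = u)] {S : Set Ω.T}
    (hS : S ⊆ Ω.fiberIm I u) {R : Set (Fib Ω.toFellBundleData u)}
    (hR : closure (Submodule.span ℂ R : Set (Fib Ω.toFellBundleData u)) = Set.univ)
    (h : ∀ e ∈ hI.fib u, ∀ a ∈ R, ∀ e' ∈ hI.fib u, (e * a * e').val ∈ S) :
    Ω.closedSpan u S = Ω.fiberIm I u := by
  have hJ := hI.isClosedIdeal_fib u
  have hcl : (hI.fib u : Set (Fib Ω.toFellBundleData u)) =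
      closure (Submodule.span ℂ (Fib.val ⁻¹' S : Set (Fib Ω.toFellBundleData u)) :
        Set (Fib Ω.toFellBundleData u)) := by
    refine Set.Subset.antisymm ?_ ?_
    · exact hJ.le_of_mul_mul_mem (M := (Submodule.span ℂ (Fib.val ⁻¹' S)).topologicalClosure)
        (Submodule.isClosed_topologicalClosure _) hR fun e he a ha e' he' =>
          Submodule.le_topologicalClosure _ (Submodule.subset_span (h e he a ha e' he'))
    · refine hJ.isClosed.closure_subset_iff.mpr (Submodule.span_le.mpr fun w hw => ?_)
      exact hI.mem_fib.mpr (hS hw)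
  rw [closedSpan_eq u fun t ht => mem_fiberIm hI (hS ht), ← hcl]
  ext t
  constructor
  · rintro ⟨t, ht, rfl⟩
    exact hI.mem_fib.mp ht
  · exact fun ht => ⟨⟨t, mem_fiberIm hI ht⟩, hI.mem_fib.mpr ht, rfl⟩

lemma linner_full (hG : Ω.GInvariant I) (x : Ω.G) :
    Ω.closedSpan (Ω.rng x) {t | ∃ a b, a ∈ Ω.BIset I ∧ b ∈ Ω.BIset I ∧ Ω.p a = x ∧ Ω.p b = x ∧
      t = Ω.bmul a (Ω.bstar b)} = Ω.fiberIm I (Ω.rng x) := by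
  have hmem : ∀ e ∈ hG.1.fib (Ω.rng x), ∀ a, (lmul e a).val ∈ Ω.BIset I := by
    intro e he a
    rw [mem_BIset hG.1, rinner_lmul_left, lmul_lmul]
    exact hG.rinner_lmul_mem ((hG.1.isClosedIdeal_fib _).mul_mem_left _ e he) a a
  refine Ω.closedSpan_eq_fiberIm hG.1 ?_ (Ω.closure_span_linner x) ?_
  · rintro _ ⟨a, b, ha, -, hpa, hpb, rfl⟩
    exact hG.1.mem_fib.mp (hG.linner_mem ((mem_BIset hG.1 ⟨a, hpa⟩).mp ha) ⟨b, hpb⟩)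
  · rintro e he _ ⟨a, b, rfl⟩ e' he'
    refine ⟨_, _, hmem e he a, hmem _ ((hG.1.isClosedIdeal_fib _).star_mem he') b, p_val _,
      p_val _, ?_⟩
    rw [← linner_val, linner_lmul_left, linner_lmul, star_star, mul_assoc]

lemma rinner_full (hI : Ω.IsIdealA I) (x : Ω.G) :
    Ω.closedSpan (Ω.src x) {t | ∃ a b, a ∈ Ω.BIset I ∧ b ∈ Ω.BIset I ∧ Ω.p a = x ∧ Ω.p b = x ∧
      t = Ω.bmul (Ω.bstar a) b} = Ω.fiberIm I (Ω.src x) := by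
  have hJ := hI.isClosedIdeal_fib (Ω.src x)
  have hmem : ∀ e ∈ hI.fib (Ω.src x), ∀ a, (rmul a e).val ∈ Ω.BIset I := fun e he a =>
    (mem_BIset hI _).mpr (rinner_rmul_self_mem hJ a he)
  refine Ω.closedSpan_eq_fiberIm hI ?_ (Ω.closure_span_rinner x) ?_
  · rintro _ ⟨a, b, -, hb, hpa, hpb, rfl⟩
    exact hI.mem_fib.mp (rinner_mem hJ ((mem_BIset hI ⟨b, hpb⟩).mp hb) ⟨a, hpa⟩)
  · rintro e he _ ⟨a, b, rfl⟩ e' he'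
    refine ⟨_, _, hmem _ (hJ.star_mem he) a, hmem e' he' b, p_val _, p_val _, ?_⟩
    rw [← rinner_val, rinner_rmul, rinner_rmul_left, star_star]

end FellBundle

/-- Let `p : B → G` be a Fell bundle over a locally compact
Hausdorff groupoid, `A := Γ₀(G⁰; B)`, `I` an ideal of `A`, and
`B_I := {b : b* b ∈ I(s(b))}` with `p_I := p|_{B_I}`.  Then `p_I : B_I → G` (with
the subspace topology) is an upper semicontinuous Banach bundle with fibres
`B_I(x) = B(x) · I(s(x))`; the only nontrivial points beyond the (automatically
inherited) axioms are that `p_I` is open and that the fibres are the stated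
closed subspaces.  If moreover `I` is `G`-invariant, then `B_I` is a Fell bundle
with the operations inherited from `B`: it is closed under multiplication and
involution, its unit fibres are `B_I(u) = I(u)`, and each `B_I(x)` is an
`I(r(x)) – I(s(x))`-imprimitivity bimodule (the inner products `a b*` and `a* b`
take values in `I(r(x))` resp. `I(s(x))` and are full). -/
theorem BIset_subbundle (Ω : FellBundle)
    (I : Set (Ω.toLCGroupoid.UnitSpace → Ω.T)) (hI : Ω.toFellBundleData.IsIdealA I) :
    (IsOpenMap fun b : {b : Ω.T // b ∈ Ω.toFellBundleData.BIset I} => Ω.p b.1) ∧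
    (∀ x : Ω.G, {b | b ∈ Ω.toFellBundleData.BIset I ∧ Ω.p b = x} =
      Ω.toFellBundleData.closedSpan x
        {t | ∃ c d, Ω.p c = x ∧ d ∈ Ω.toFellBundleData.fiberIm I (Ω.src x) ∧
          t = Ω.bmul c d}) ∧
    (Ω.toFellBundleData.GInvariant I →
      (∀ a b, a ∈ Ω.toFellBundleData.BIset I → b ∈ Ω.toFellBundleData.BIset I →
        Ω.src (Ω.p a) = Ω.rng (Ω.p b) → Ω.bmul a b ∈ Ω.toFellBundleData.BIset I) ∧
      (∀ a, a ∈ Ω.toFellBundleData.BIset I → Ω.bstar a ∈ Ω.toFellBundleData.BIset I) ∧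
      (∀ u : Ω.G, Ω.rng u = u →
        {b | b ∈ Ω.toFellBundleData.BIset I ∧ Ω.p b = u} =
          Ω.toFellBundleData.fiberIm I u) ∧
      (∀ a b, a ∈ Ω.toFellBundleData.BIset I → b ∈ Ω.toFellBundleData.BIset I →
        Ω.p a = Ω.p b →
        Ω.bmul a (Ω.bstar b) ∈ Ω.toFellBundleData.fiberIm I (Ω.rng (Ω.p a)) ∧
        Ω.bmul (Ω.bstar a) b ∈ Ω.toFellBundleData.fiberIm I (Ω.src (Ω.p a))) ∧
      (∀ x : Ω.G,
        Ω.toFellBundleData.closedSpan (Ω.rng x)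
            {t | ∃ a b, a ∈ Ω.toFellBundleData.BIset I ∧
              b ∈ Ω.toFellBundleData.BIset I ∧ Ω.p a = x ∧ Ω.p b = x ∧
              t = Ω.bmul a (Ω.bstar b)} =
          Ω.toFellBundleData.fiberIm I (Ω.rng x) ∧
        Ω.toFellBundleData.closedSpan (Ω.src x)
            {t | ∃ a b, a ∈ Ω.toFellBundleData.BIset I ∧
              b ∈ Ω.toFellBundleData.BIset I ∧ Ω.p a = x ∧ Ω.p b = x ∧
              t = Ω.bmul (Ω.bstar a) b} =
          Ω.toFellBundleData.fiberIm I (Ω.src x))) := by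
  refine ⟨FellBundleData.isOpenMap_BIset hI, FellBundleData.BIset_fiber hI, fun hG =>
    ⟨fun a b ha _ hab => hG.bmul_mem_BIset ha hab, fun a ha => hG.bstar_mem_BIset ha,
      fun u hu => FellBundleData.BIset_unit_fiber hI hu, fun a b ha hb hab => ⟨?_, ?_⟩,
      fun x => ⟨Ω.linner_full hG x, Ω.rinner_full hI x⟩⟩⟩
  · exact hI.mem_fib.mp (hG.linner_mem ((FellBundleData.mem_BIset hI ⟨a, rfl⟩).mp ha)
      ⟨b, hab.symm⟩)
  · exact hI.mem_fib.mp (FellBundleData.Fib.rinner_mem (hI.isClosedIdeal_fib _)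
      ((FellBundleData.mem_BIset hI ⟨b, hab.symm⟩).mp hb) ⟨a, rfl⟩)
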